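/- arXiv:2110.05605 — 11 statements merged into one kernel-verified Lean document; each statement's English description precedes it below -/
import Mathlib

section
/- One-step expected contraction of randomized Kaczmarz for consistent systems: Let A ∈ ℝ^{m×n} be a nonzero matrix, b ∈ ℝ^m, and x* ∈ ℝ^n with A x* = b. Let σ > 0 be such that ‖A v‖² ≥ σ² ‖v‖² for every v in the row space of A (the span of the rows of A). Then for every x ∈ ℝ^n with x − x* in the row space of A, ∑_{i=1}^m (‖A_{i:}‖²/‖A‖_F²) · ‖x − ((A_{i:} x − b_i)/‖A_{i:}‖²) A_{i:}ᵀ − x*‖² ≤ (1 − σ²/‖A‖_F²) ‖x − x*‖², where terms with A_{i:} = 0 carry zero weight. -/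
open Matrix BigOperators

/-- Pythagoras for the projection of `v` onto the hyperplane orthogonal to `a`, multiplied by
the squared length of `a` so that it also holds for `a = 0`. -/
theorem sum_sq_mul_sum_sq_sub_proj {ι : Type*} [Fintype ι] (a v : ι → ℝ) :
    (∑ l, a l ^ 2) * ∑ l, (v l - (a ⬝ᵥ v) / (∑ l', a l' ^ 2) * a l) ^ 2
      = (∑ l, a l ^ 2) * (∑ l, v l ^ 2) - (a ⬝ᵥ v) ^ 2 := by
  have expand (c : ℝ) : ∑ l, (v l - c * a l) ^ 2
      = ∑ l, v l ^ 2 - 2 * c * (a ⬝ᵥ v) + c ^ 2 * ∑ l, a l ^ 2 := by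
    simp only [dotProduct, Finset.mul_sum, ← Finset.sum_sub_distrib, ← Finset.sum_add_distrib]
    exact Finset.sum_congr rfl fun l _ => by ring
  rw [expand]
  by_cases hs : ∑ l, a l ^ 2 = 0
  · have ha : a = 0 := by
      funext l
      have h := (Finset.sum_eq_zero_iff_of_nonneg fun l _ => sq_nonneg (a l)).1 hs l
        (Finset.mem_univ l)
      exact pow_eq_zero_iff two_ne_zero |>.1 h
    simp [ha]
  · field_simp
    ring

/-- The squared Frobenius norm of a nonzero real matrix is positive. -/
theorem sum_sum_sq_pos {ι κ : Type*} [Fintype ι] [Fintype κ] {A : Matrix ι κ ℝ} (hA : A ≠ 0) :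
    0 < ∑ i, ∑ l, A i l ^ 2 := by
  obtain ⟨i, l, hil⟩ : ∃ i l, A i l ≠ 0 := by
    by_contra! h
    exact hA (Matrix.ext h)
  exact Finset.sum_pos' (fun i _ => Finset.sum_nonneg fun l _ => sq_nonneg _)
    ⟨i, Finset.mem_univ i, Finset.sum_pos' (fun l _ => sq_nonneg _)
      ⟨l, Finset.mem_univ l, by positivity⟩⟩

/-- One-step expected contraction of randomized Kaczmarz for consistent systems. -/
theorem rk_one_step_contraction {m n : ℕ}
    (A : Matrix (Fin m) (Fin n) ℝ) (b : Fin m → ℝ) (xs : Fin n → ℝ) (σ : ℝ)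
    (hA : A ≠ 0)
    (hsol : A.mulVec xs = b)
    (hσ : 0 < σ)
    (hmin : ∀ v ∈ Submodule.span ℝ (Set.range fun i : Fin m => A i),
      σ ^ 2 * (∑ l, v l ^ 2) ≤ ∑ l, A.mulVec v l ^ 2)
    (x : Fin n → ℝ)
    (hx : x - xs ∈ Submodule.span ℝ (Set.range fun i : Fin m => A i)) :
    ∑ i, ((∑ l, A i l ^ 2) / (∑ i', ∑ l, A i' l ^ 2)) *
        (∑ l, (x - ((A.mulVec x i - b i) / (∑ l', A i l' ^ 2)) • A i - xs) l ^ 2)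
      ≤ (1 - σ ^ 2 / (∑ i', ∑ l, A i' l ^ 2)) * ∑ l, (x - xs) l ^ 2 := by
  have hF := sum_sum_sq_pos hA
  have hmv := hmin _ hx
  have hterm (i : Fin m) : ((∑ l, A i l ^ 2) / (∑ i', ∑ l, A i' l ^ 2)) *
        (∑ l, (x - ((A.mulVec x i - b i) / (∑ l', A i l' ^ 2)) • A i - xs) l ^ 2)
      = ((∑ l, A i l ^ 2) * (∑ l, (x - xs) l ^ 2) - A.mulVec (x - xs) i ^ 2)
        / (∑ i', ∑ l, A i' l ^ 2) := by
    have hres : A.mulVec x i - b i = A i ⬝ᵥ (x - xs) := by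
      rw [← hsol, dotProduct_sub]
      rfl
    have hproj := sum_sq_mul_sum_sq_sub_proj (A i) (x - xs)
    rw [hres, div_mul_eq_mul_div]
    congr 1
    refine Eq.trans ?_ hproj
    congr 1
    refine Finset.sum_congr rfl fun l _ => ?_
    simp only [Pi.sub_apply, Pi.smul_apply, smul_eq_mul]
    ring
  rw [Finset.sum_congr rfl fun i _ => hterm i, ← Finset.sum_div, Finset.sum_sub_distrib,
    ← Finset.sum_mul, div_le_iff₀ hF, mul_right_comm, sub_mul, div_mul_cancel₀ _ hF.ne', one_mul,
    sub_mul]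
  exact sub_le_sub_left hmv _
end

section
/- Convergence of randomized Kaczmarz (Theorem 1): Let A ∈ ℝ^{m×n} be a nonzero matrix with every row nonzero, b ∈ ℝ^m, and suppose A x* = b with x* in the row space of A. Let σ > 0 satisfy ‖A v‖² ≥ σ² ‖v‖² for every v in the row space of A. Fix x^0 in the row space of A, and for each index sequence ω = (i_1,…,i_k) ∈ {1,…,m}^k define RK iterates x^t(ω) = x^{t−1}(ω) − ((A_{i_t:} x^{t−1}(ω) − b_{i_t})/‖A_{i_t:}‖²) A_{i_t:}ᵀ. Then ∑_{ω ∈ {1,…,m}^k} (∏_{t=1}^k ‖A_{i_t:}‖²/‖A‖_F²) · ‖x^k(ω) − x*‖² ≤ (1 − σ²/‖A‖_F²)^k ‖x^0 − x*‖². -/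
open Matrix BigOperators

/-- The randomized Kaczmarz update of `x` with row index `i`. -/
noncomputable def rkStep {m n : ℕ} (A : Matrix (Fin m) (Fin n) ℝ) (b : Fin m → ℝ)
    (x : Fin n → ℝ) (i : Fin m) : Fin n → ℝ :=
  x - ((A.mulVec x i - b i) / (∑ l, A i l ^ 2)) • A i

/-- If one random step contracts `d` by a factor `c` in expectation on the invariant set `P`,
then `k` independent steps contract it by `c ^ k`. -/
lemma sum_prod_mul_foldl_le {ι α : Type*} [Fintype ι] (P : α → Prop) (d : α → ℝ)
    (step : α → ι → α) (w : ι → ℝ) (hw : ∀ i, 0 ≤ w i) {c : ℝ} (hc : 0 ≤ c)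
    (hP : ∀ x, P x → ∀ i, P (step x i))
    (hstep : ∀ x, P x → ∑ i, w i * d (step x i) ≤ c * d x) (k : ℕ) :
    ∀ x, P x → ∑ ω : Fin k → ι, (∏ t, w (ω t)) * d ((List.ofFn ω).foldl step x)
      ≤ c ^ k * d x := by
  induction k with
  | zero => intro x _; simp
  | succ k ih =>
    intro x hx
    rw [← (Fin.consEquiv fun _ : Fin (k + 1) => ι).sum_comp, Fintype.sum_prod_type]
    calc _ = ∑ i, w i * ∑ ω : Fin k → ι,
            (∏ t, w (ω t)) * d ((List.ofFn ω).foldl step (step x i)) := by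
          simp [Fin.consEquiv, Fin.prod_univ_succ, List.ofFn_succ, Finset.mul_sum, mul_assoc]
      _ ≤ ∑ i, w i * (c ^ k * d (step x i)) := by
          gcongr with i
          · exact hw i
          · exact ih _ (hP x hx i)
      _ = c ^ k * ∑ i, w i * d (step x i) := by
          rw [Finset.mul_sum]
          exact Finset.sum_congr rfl fun i _ => by ring
      _ ≤ c ^ k * (c * d x) := by gcongr; exact hstep x hx
      _ = c ^ (k + 1) * d x := by ring

lemma sum_sq_pos {κ : Type*} [Fintype κ] {v : κ → ℝ} (hv : v ≠ 0) : 0 < ∑ l, v l ^ 2 := by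
  obtain ⟨l, hl⟩ := Function.ne_iff.mp hv
  exact Finset.sum_pos' (fun _ _ => sq_nonneg _) ⟨l, Finset.mem_univ l, sq_pos_of_ne_zero hl⟩

/-- Pythagoras for a Kaczmarz step: the step projects the error orthogonally to the row. -/
lemma sum_sq_mul_sum_sq_rkStep_sub {m n : ℕ} (A : Matrix (Fin m) (Fin n) ℝ) (xs x : Fin n → ℝ)
    {i : Fin m} (hi : A i ≠ 0) :
    (∑ l, A i l ^ 2) * ∑ l, (rkStep A (A.mulVec xs) x i - xs) l ^ 2
      = (∑ l, A i l ^ 2) * ∑ l, (x - xs) l ^ 2 - A.mulVec (x - xs) i ^ 2 := by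
  have hr := (sum_sq_pos hi).ne'
  have hdot : A.mulVec (x - xs) i = ∑ l, A i l * (x - xs) l := rfl
  have hsub : A.mulVec x i - A.mulVec xs i = A.mulVec (x - xs) i := by
    rw [Matrix.mulVec_sub, Pi.sub_apply]
  have hexp (t : ℝ) : ∑ l, (x - t • A i - xs) l ^ 2
      = ∑ l, (x - xs) l ^ 2 - 2 * t * A.mulVec (x - xs) i + t ^ 2 * ∑ l, A i l ^ 2 := by
    rw [hdot, Finset.mul_sum, Finset.mul_sum, ← Finset.sum_sub_distrib, ← Finset.sum_add_distrib]
    refine Finset.sum_congr rfl fun l _ => ?_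
    simp only [Pi.sub_apply, Pi.smul_apply, smul_eq_mul]
    ring
  rw [rkStep, hsub, hexp]
  field_simp
  ring

/-- The expected squared error after one randomized Kaczmarz step. -/
lemma sum_mul_sum_sq_rkStep_sub {m n : ℕ} (A : Matrix (Fin m) (Fin n) ℝ) (xs x : Fin n → ℝ)
    (hrows : ∀ i, A i ≠ 0) (hF : (∑ i, ∑ l, A i l ^ 2) ≠ 0) :
    ∑ i, (∑ l, A i l ^ 2) / (∑ i', ∑ l, A i' l ^ 2) *
        ∑ l, (rkStep A (A.mulVec xs) x i - xs) l ^ 2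
      = ∑ l, (x - xs) l ^ 2
        - (∑ i, A.mulVec (x - xs) i ^ 2) / (∑ i', ∑ l, A i' l ^ 2) := by
  simp_rw [div_mul_eq_mul_div, sum_sq_mul_sum_sq_rkStep_sub A xs x (hrows _)]
  rw [← Finset.sum_div, Finset.sum_sub_distrib, ← Finset.sum_mul]
  field_simp

/-- Convergence of randomized Kaczmarz (Theorem 1). -/
theorem rk_convergence {m n : ℕ} (k : ℕ)
    (A : Matrix (Fin m) (Fin n) ℝ) (b : Fin m → ℝ) (xs : Fin n → ℝ) (σ : ℝ)
    (hA : A ≠ 0)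
    (hrows : ∀ i, A i ≠ 0)
    (hsol : A.mulVec xs = b)
    (hxs : xs ∈ Submodule.span ℝ (Set.range fun i : Fin m => A i))
    (hσ : 0 < σ)
    (hmin : ∀ v ∈ Submodule.span ℝ (Set.range fun i : Fin m => A i),
      σ ^ 2 * (∑ l, v l ^ 2) ≤ ∑ l, A.mulVec v l ^ 2)
    (x0 : Fin n → ℝ)
    (hx0 : x0 ∈ Submodule.span ℝ (Set.range fun i : Fin m => A i)) :
    ∑ ω : Fin k → Fin m,
        (∏ t, (∑ l, A (ω t) l ^ 2) / (∑ i', ∑ l, A i' l ^ 2)) *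
          (∑ l, ((List.ofFn ω).foldl (rkStep A b) x0 - xs) l ^ 2)
      ≤ (1 - σ ^ 2 / (∑ i', ∑ l, A i' l ^ 2)) ^ k * ∑ l, (x0 - xs) l ^ 2 := by
  subst hsol
  set V := Submodule.span ℝ (Set.range fun i : Fin m => A i)
  set F := ∑ i', ∑ l, A i' l ^ 2
  have hrow (i : Fin m) : A i ∈ V := Submodule.subset_span ⟨i, rfl⟩
  obtain ⟨i₀, -⟩ := Function.ne_iff.mp hA
  have hF : 0 < F := Finset.sum_pos (fun i _ => sum_sq_pos (hrows i)) ⟨i₀, Finset.mem_univ _⟩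
  have hw (i : Fin m) : 0 ≤ (∑ l, A i l ^ 2) / F := by positivity
  have hstep (x : Fin n → ℝ) (hx : x ∈ V) :
      ∑ i, (∑ l, A i l ^ 2) / F * ∑ l, (rkStep A (A.mulVec xs) x i - xs) l ^ 2
        ≤ (1 - σ ^ 2 / F) * ∑ l, (x - xs) l ^ 2 := by
    rw [sum_mul_sum_sq_rkStep_sub A xs x hrows hF.ne', sub_mul, one_mul, div_mul_eq_mul_div]
    gcongr
    exact hmin _ (V.sub_mem hx hxs)
  have hc : 0 ≤ 1 - σ ^ 2 / F := by
    have h := hstep (A i₀ + xs) (V.add_mem (hrow i₀) hxs)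
    rw [add_sub_cancel_right] at h
    refine nonneg_of_mul_nonneg_left (le_trans ?_ h) (sum_sq_pos (hrows i₀))
    exact Finset.sum_nonneg fun i _ => mul_nonneg (hw i) (by positivity)
  exact sum_prod_mul_foldl_le (· ∈ V) (fun x => ∑ l, (x - xs) l ^ 2) (rkStep A (A.mulVec xs))
    (fun i => (∑ l, A i l ^ 2) / F) hw hc
    (fun x hx i => V.sub_mem hx (V.smul_mem _ (hrow i))) hstep k x0 hx0
end

section
/- One-step expected bound for the x-update of randomized extended Kaczmarz: Let A ∈ ℝ^{m×n} have every row nonzero, b ∈ ℝ^m, and let x* satisfy Aᵀ(A x* − b) = 0 with x* in the row space of A; set z* = b − A x* (the orthogonal projection of b onto the orthogonal complement of the column space of A). Let σ > 0 satisfy ‖A v‖² ≥ σ² ‖v‖² for every v in the row space of A. Then for every x ∈ ℝ^n with x − x* in the row space of A and every z ∈ ℝ^m, ∑_{i=1}^m (‖A_{i:}‖²/‖A‖_F²) · ‖x − ((A_{i:} x − b_i + z_i)/‖A_{i:}‖²) A_{i:}ᵀ − x*‖² ≤ (1 − σ²/‖A‖_F²) ‖x − x*‖² + (1/‖A‖_F²)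 ‖z − z*‖². -/
open Matrix BigOperators

/-- Squared length of a vector after subtracting a multiple of `a`, scaled by the squared length
of `a`: the excess over the scaled length of `e` is `d ^ 2 - ⟨a, e⟩ ^ 2`. -/
lemma sum_sq_mul_sum_sq_sub_smul {ι : Type*} [Fintype ι] (a e : ι → ℝ) (d : ℝ)
    (ha : ∑ l, a l ^ 2 ≠ 0) :
    (∑ l, a l ^ 2) * ∑ l, (e l - (a ⬝ᵥ e + d) / (∑ l', a l' ^ 2) * a l) ^ 2
      = (∑ l, a l ^ 2) * (∑ l, e l ^ 2) - (a ⬝ᵥ e) ^ 2 + d ^ 2 := by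
  have expand (c : ℝ) : ∑ l, (e l - c * a l) ^ 2
      = ∑ l, e l ^ 2 - 2 * c * (a ⬝ᵥ e) + c ^ 2 * ∑ l, a l ^ 2 := by
    simp only [dotProduct, Finset.mul_sum, ← Finset.sum_sub_distrib, ← Finset.sum_add_distrib]
    exact Finset.sum_congr rfl fun l _ => by ring
  rw [expand]
  field_simp
  ring

/-- One-step expected bound for the x-update of randomized extended Kaczmarz. -/
theorem rek_x_one_step_bound {m n : ℕ}
    (A : Matrix (Fin m) (Fin n) ℝ) (b : Fin m → ℝ) (xs : Fin n → ℝ) (σ : ℝ)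
    (hrows : ∀ i, A i ≠ 0)
    (hnormal : Aᵀ.mulVec (A.mulVec xs - b) = 0)
    (hxs : xs ∈ Submodule.span ℝ (Set.range fun i : Fin m => A i))
    (zs : Fin m → ℝ) (hzs : zs = b - A.mulVec xs)
    (hσ : 0 < σ)
    (hmin : ∀ v ∈ Submodule.span ℝ (Set.range fun i : Fin m => A i),
      σ ^ 2 * (∑ l, v l ^ 2) ≤ ∑ l, A.mulVec v l ^ 2)
    (x : Fin n → ℝ)
    (hx : x - xs ∈ Submodule.span ℝ (Set.range fun i : Fin m => A i))
    (z : Fin m → ℝ) :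
    ∑ i, ((∑ l, A i l ^ 2) / (∑ i', ∑ l, A i' l ^ 2)) *
        (∑ l, (x - ((A.mulVec x i - b i + z i) / (∑ l', A i l' ^ 2)) • A i - xs) l ^ 2)
      ≤ (1 - σ ^ 2 / (∑ i', ∑ l, A i' l ^ 2)) * (∑ l, (x - xs) l ^ 2)
        + (1 / (∑ i', ∑ l, A i' l ^ 2)) * ∑ i, (z - zs) i ^ 2 := by
  have hpos (i : Fin m) : ∑ l, A i l ^ 2 ≠ 0 := by
    intro h
    rw [Finset.sum_eq_zero_iff_of_nonneg fun _ _ => sq_nonneg _] at h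
    exact hrows i (funext fun l => pow_eq_zero_iff two_ne_zero |>.mp (h l (Finset.mem_univ l)))
  have hstep (i : Fin m) (l : Fin n) :
      (x - ((A.mulVec x i - b i + z i) / (∑ l', A i l' ^ 2)) • A i - xs) l
        = (x - xs) l - (A i ⬝ᵥ (x - xs) + (z - zs) i) / (∑ l', A i l' ^ 2) * A i l := by
    simp only [hzs, Pi.sub_apply, Pi.smul_apply, smul_eq_mul, mulVec, dotProduct_sub]
    ring
  have hmin' := hmin _ hx
  have hterm (i : Fin m) (F : ℝ) :
      (∑ l, A i l ^ 2) / F *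
          (∑ l, (x - ((A.mulVec x i - b i + z i) / (∑ l', A i l' ^ 2)) • A i - xs) l ^ 2)
        = ((∑ l, A i l ^ 2) * (∑ l, (x - xs) l ^ 2) - A.mulVec (x - xs) i ^ 2
          + (z - zs) i ^ 2) / F := by
    simp only [hstep]
    rw [div_mul_eq_mul_div, sum_sq_mul_sum_sq_sub_smul (A i) (x - xs) _ (hpos i)]
    rfl
  simp only [hterm]
  rw [← Finset.sum_div, Finset.sum_add_distrib, Finset.sum_sub_distrib, ← Finset.sum_mul]
  have hF : 0 ≤ ∑ i, ∑ l, A i l ^ 2 :=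
    Finset.sum_nonneg fun _ _ => Finset.sum_nonneg fun _ _ => sq_nonneg _
  set F := ∑ i, ∑ l, A i l ^ 2
  rcases hF.eq_or_lt with hF0 | hFpos
  · simp only [← hF0, div_zero, sub_zero, one_mul, zero_mul, add_zero]
    exact Finset.sum_nonneg fun _ _ => sq_nonneg _
  · rw [div_le_iff₀ hFpos]
    field_simp
    linarith
end

section
/- The sketch-and-project update is the B-norm projection onto the sketched solution set: Let M ∈ ℝ^{m×n}, c ∈ ℝ^m, let B ∈ ℝ^{n×n} be symmetric positive definite, and let S ∈ ℝ^{m×q}. Suppose the sketched system Sᵀ M w = Sᵀ c has at least one solution. Let P ∈ ℝ^{q×q} satisfy the four Moore–Penrose equations for G = Sᵀ M B⁻¹ Mᵀ S (i.e., G P G = G, P G P = P, (G P)ᵀ = G P, (P G)ᵀ = P G). Then for every y ∈ ℝ^n, the vector y⁺ = y − B⁻¹ Mᵀ S P Sᵀ (M y − c) satisfies Sᵀ M y⁺ = Sᵀ c, and for every w with Sᵀ M w = Sᵀ c one has (y⁺ − y)ᵀ B (y⁺ − y) ≤ (w − y)ᵀ B (w − y). -/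
open Matrix BigOperators

/-- A positive definite form that vanishes on the rows of a matrix forces the matrix to vanish. -/
theorem Matrix.PosDef.eq_zero_of_mul_mul_transpose_eq_zero {ι κ : Type*} [Fintype ι] [Fintype κ]
    {N : Matrix κ κ ℝ} (hN : N.PosDef) {D : Matrix ι κ ℝ} (h : D * N * Dᵀ = 0) : D = 0 := by
  funext i
  by_contra hne
  have hpos := hN.dotProduct_mulVec_pos (x := D i) hne
  have hii : (D * N * Dᵀ) i i = D i ⬝ᵥ N *ᵥ D i := by
    rw [dotProduct_mulVec]
    rfl
  rw [h] at hii
  simp only [star_trivial] at hpos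
  rw [← hii] at hpos
  exact lt_irrefl _ hpos

/-- If `P` is an inner inverse of the Gram matrix `A N Aᵀ`, then `A N Aᵀ P` fixes `A`. -/
theorem Matrix.PosDef.gram_mul_innerInverse_mul {ι κ : Type*} [Fintype ι] [Fintype κ]
    {N : Matrix κ κ ℝ} (hN : N.PosDef) (A : Matrix ι κ ℝ) (P : Matrix ι ι ℝ)
    (hP : A * N * Aᵀ * P * (A * N * Aᵀ) = A * N * Aᵀ) : A * N * Aᵀ * P * A = A := by
  have h : (A - A * N * Aᵀ * P * A) * N * (A - A * N * Aᵀ * P * A)ᵀ = 0 := by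
    have hleft : (A - A * N * Aᵀ * P * A) * N * Aᵀ = 0 := by
      simp only [Matrix.sub_mul, Matrix.mul_assoc] at hP ⊢
      rw [hP, sub_self]
    rw [transpose_sub, transpose_mul _ A, Matrix.mul_sub, ← Matrix.mul_assoc, hleft]
    simp
  exact (sub_eq_zero.mp (hN.eq_zero_of_mul_mul_transpose_eq_zero h)).symm

/-- Adding a `B`-orthogonal vector does not decrease the `B`-norm. -/
theorem Matrix.PosDef.dotProduct_mulVec_le_add_of_orthogonal {κ : Type*} [Fintype κ]
    {B : Matrix κ κ ℝ} (hB : B.PosDef) {z h : κ → ℝ} (hzh : h ⬝ᵥ B *ᵥ z = 0) :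
    z ⬝ᵥ B *ᵥ z ≤ (z + h) ⬝ᵥ B *ᵥ (z + h) := by
  have hnonneg : 0 ≤ h ⬝ᵥ B *ᵥ h := by
    simpa using hB.posSemidef.dotProduct_mulVec_nonneg h
  have hsymm : Bᵀ = B := by simpa using hB.isHermitian.eq
  have hcomm : z ⬝ᵥ B *ᵥ h = 0 := by
    rw [dotProduct_mulVec, ← mulVec_transpose, hsymm, dotProduct_comm, hzh]
  rw [mulVec_add, add_dotProduct, dotProduct_add, dotProduct_add, hzh, hcomm]
  linarith

/-- The sketch-and-project update is the B-norm projection onto the sketched solution set. -/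
theorem sap_update_is_projection {m n q : ℕ}
    (M : Matrix (Fin m) (Fin n) ℝ) (c : Fin m → ℝ)
    (B : Matrix (Fin n) (Fin n) ℝ) (hB : B.PosDef)
    (S : Matrix (Fin m) (Fin q) ℝ)
    (hcons : ∃ w : Fin n → ℝ, (Sᵀ * M).mulVec w = Sᵀ.mulVec c)
    (G : Matrix (Fin q) (Fin q) ℝ) (hG : G = Sᵀ * M * B⁻¹ * Mᵀ * S)
    (P : Matrix (Fin q) (Fin q) ℝ)
    (hP1 : G * P * G = G) (hP2 : P * G * P = P)
    (hP3 : (G * P)ᵀ = G * P) (hP4 : (P * G)ᵀ = P * G)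
    (y : Fin n → ℝ)
    (yplus : Fin n → ℝ)
    (hyplus : yplus = y - (B⁻¹ * Mᵀ * S * P * Sᵀ).mulVec (M.mulVec y - c)) :
    (Sᵀ * M).mulVec yplus = Sᵀ.mulVec c ∧
    ∀ w : Fin n → ℝ, (Sᵀ * M).mulVec w = Sᵀ.mulVec c →
      (yplus - y) ⬝ᵥ B.mulVec (yplus - y) ≤ (w - y) ⬝ᵥ B.mulVec (w - y) := by
  obtain ⟨w₀, hw₀⟩ := hcons
  have hunit : IsUnit B.det := (Matrix.isUnit_iff_isUnit_det B).mp hB.isUnit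
  have hGA : G = (Sᵀ * M) * B⁻¹ * (Sᵀ * M)ᵀ := by
    rw [hG, transpose_mul, transpose_transpose]
    simp only [Matrix.mul_assoc]
  have hfix : G * P * (Sᵀ * M) = Sᵀ * M := by
    rw [hGA] at hP1 ⊢
    exact hB.inv.gram_mul_innerInverse_mul _ _ hP1
  have hres : Sᵀ *ᵥ (M *ᵥ y - c) = (Sᵀ * M) *ᵥ (y - w₀) := by
    rw [mulVec_sub, mulVec_sub, hw₀, mulVec_mulVec]
  have hstep : yplus - y =
      -((B⁻¹ * (Sᵀ * M)ᵀ) *ᵥ (P *ᵥ (Sᵀ *ᵥ (M *ᵥ y - c)))) := by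
    rw [hyplus, sub_sub_cancel_left, transpose_mul, transpose_transpose]
    simp only [mulVec_mulVec, Matrix.mul_assoc]
  have hsol : (Sᵀ * M) *ᵥ yplus = Sᵀ *ᵥ c := by
    have hmove : (Sᵀ * M) *ᵥ (yplus - y) = -((Sᵀ * M) *ᵥ (y - w₀)) := by
      rw [hstep, hres, mulVec_neg, mulVec_mulVec, mulVec_mulVec, mulVec_mulVec,
        ← Matrix.mul_assoc (Sᵀ * M) B⁻¹, ← hGA, hfix]
    rw [mulVec_sub, mulVec_sub, hw₀] at hmove
    linear_combination hmove
  refine ⟨hsol, fun w hw => ?_⟩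
  have hker : (Sᵀ * M) *ᵥ (w - yplus) = 0 := by rw [mulVec_sub, hw, hsol, sub_self]
  have horth : (w - yplus) ⬝ᵥ B *ᵥ (yplus - y) = 0 := by
    rw [hstep, mulVec_neg, mulVec_mulVec, ← Matrix.mul_assoc, Matrix.mul_nonsing_inv B hunit,
      Matrix.one_mul, dotProduct_neg, dotProduct_mulVec, vecMul_transpose, hker,
      zero_dotProduct, neg_zero]
  have hle := hB.dotProduct_mulVec_le_add_of_orthogonal horth
  rwa [show yplus - y + (w - yplus) = w - y by abel] at hle
end

section
/- One-step expected contraction of sketch-and-project (Theorem 4, one-step form): Let M ∈ ℝ^{m×n}, c ∈ ℝ^m, y* ∈ ℝ^n with M y* = c, and let B ∈ ℝ^{n×n} be symmetric positive definite. Let S_1,…,S_r be sketching matrices (S_l ∈ ℝ^{m×q_l}) with probabilities p_l ≥ 0, ∑_l p_l = 1, and for each l let P_l satisfy the four Moore–Penrose equations for G_l = S_lᵀ M B⁻¹ Mᵀ S_l. Set Z_l = Mᵀ S_l P_l S_lᵀ M and E[Z] = ∑_l p_l Z_l. Suppose λ ≥ 0 is such that vᵀ E[Z] v ≥ λ ·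 vᵀ B v for all v ∈ ℝ^n. Then for every y ∈ ℝ^n, with y⁺_l = y − B⁻¹ Mᵀ S_l P_l S_lᵀ (M y − c), one has ∑_{l=1}^r p_l (y⁺_l − y*)ᵀ B (y⁺_l − y*) ≤ (1 − λ) (y − y*)ᵀ B (y − y*). -/
open Matrix BigOperators

/-- A Moore–Penrose inverse `P` of a symmetric matrix `G` satisfies `Pᵀ G P = Pᵀ`. -/
theorem transpose_mul_mul_of_moorePenrose {ι : Type*} [Fintype ι] {G P : Matrix ι ι ℝ}
    (hG : Gᵀ = G) (h1 : G * P * G = G) (h2 : P * G * P = P)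
    (h3 : (G * P)ᵀ = G * P) (h4 : (P * G)ᵀ = P * G) : Pᵀ * G * P = Pᵀ := by
  have h1_transpose : G * Pᵀ * G = G := by
    simpa [transpose_mul, hG, Matrix.mul_assoc] using congrArg transpose h1
  have h2_transpose : Pᵀ * G * Pᵀ = Pᵀ := by
    simpa [transpose_mul, hG, Matrix.mul_assoc] using congrArg transpose h2
  have h4_transpose : G * Pᵀ = P * G := by rw [← h4, transpose_mul, hG]
  have key : G * P = G * Pᵀ := by
    calc G * P = (G * P)ᵀ := h3.symm
      _ = ((P * G) * (G * P))ᵀ := by rw [← h4_transpose, ← Matrix.mul_assoc, h1_transpose]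
      _ = (G * P) * (P * G) := by rw [transpose_mul, h3, h4]
      _ = G * Pᵀ := by rw [← h4_transpose, ← Matrix.mul_assoc, h1]
  rw [Matrix.mul_assoc, key, ← Matrix.mul_assoc, h2_transpose]

/-- If `Zᵀ B⁻¹ Z = Zᵀ`, the step `e ↦ e - B⁻¹ Z e` decreases the squared `B`-norm
by exactly `eᵀ Z e`. -/
theorem dotProduct_mulVec_sub_inv_mulVec {ι : Type*} [Fintype ι] [DecidableEq ι]
    {B Z : Matrix ι ι ℝ} (hB : B.PosDef) (hZ : Zᵀ * B⁻¹ * Z = Zᵀ) (e : ι → ℝ) :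
    (e - (B⁻¹ * Z) *ᵥ e) ⬝ᵥ B *ᵥ (e - (B⁻¹ * Z) *ᵥ e) = e ⬝ᵥ B *ᵥ e - e ⬝ᵥ Z *ᵥ e := by
  have hdet : IsUnit B.det := hB.det_pos.ne'.isUnit
  have hBt : Bᵀ = B := by simpa using hB.isHermitian.eq
  have hcancel : B *ᵥ ((B⁻¹ * Z) *ᵥ e) = Z *ᵥ e := by
    rw [mulVec_mulVec, mul_nonsing_inv_cancel_left _ _ hdet]
  have hswap (w : ι → ℝ) : ((B⁻¹ * Z) *ᵥ e) ⬝ᵥ w = e ⬝ᵥ (Zᵀ * B⁻¹) *ᵥ w := by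
    rw [dotProduct_mulVec, ← mulVec_transpose, transpose_mul, transpose_nonsing_inv, hBt,
      transpose_transpose]
  have hcross : ((B⁻¹ * Z) *ᵥ e) ⬝ᵥ B *ᵥ e = e ⬝ᵥ Zᵀ *ᵥ e := by
    rw [hswap, mulVec_mulVec, nonsing_inv_mul_cancel_right _ _ hdet]
  have hquad : ((B⁻¹ * Z) *ᵥ e) ⬝ᵥ Z *ᵥ e = e ⬝ᵥ Zᵀ *ᵥ e := by
    rw [hswap, mulVec_mulVec, hZ]
  rw [mulVec_sub, hcancel, sub_dotProduct, dotProduct_sub, dotProduct_sub, hcross, hquad]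
  ring

/-- One-step expected contraction of sketch-and-project (Theorem 4, one-step form). -/
theorem sap_one_step_contraction {m n r : ℕ}
    (M : Matrix (Fin m) (Fin n) ℝ) (c : Fin m → ℝ)
    (ys : Fin n → ℝ) (hys : M.mulVec ys = c)
    (B : Matrix (Fin n) (Fin n) ℝ) (hB : B.PosDef)
    (q : Fin r → ℕ)
    (S : ∀ l : Fin r, Matrix (Fin m) (Fin (q l)) ℝ)
    (p : Fin r → ℝ) (hp : ∀ l, 0 ≤ p l) (hpsum : ∑ l, p l = 1)
    (P : ∀ l : Fin r, Matrix (Fin (q l)) (Fin (q l)) ℝ)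
    (G : ∀ l : Fin r, Matrix (Fin (q l)) (Fin (q l)) ℝ)
    (hG : ∀ l, G l = (S l)ᵀ * M * B⁻¹ * Mᵀ * S l)
    (hP1 : ∀ l, G l * P l * G l = G l) (hP2 : ∀ l, P l * G l * P l = P l)
    (hP3 : ∀ l, (G l * P l)ᵀ = G l * P l) (hP4 : ∀ l, (P l * G l)ᵀ = P l * G l)
    (Z : ∀ l : Fin r, Matrix (Fin n) (Fin n) ℝ)
    (hZ : ∀ l, Z l = Mᵀ * S l * P l * (S l)ᵀ * M)
    (EZ : Matrix (Fin n) (Fin n) ℝ) (hEZ : EZ = ∑ l, p l • Z l)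
    (lam : ℝ) (hlam : 0 ≤ lam)
    (hspec : ∀ v : Fin n → ℝ, lam * (v ⬝ᵥ B.mulVec v) ≤ v ⬝ᵥ EZ.mulVec v)
    (y : Fin n → ℝ)
    (yp : Fin r → (Fin n → ℝ))
    (hyp : ∀ l, yp l = y - (B⁻¹ * Mᵀ * S l * P l * (S l)ᵀ).mulVec (M.mulVec y - c)) :
    ∑ l, p l * ((yp l - ys) ⬝ᵥ B.mulVec (yp l - ys))
      ≤ (1 - lam) * ((y - ys) ⬝ᵥ B.mulVec (y - ys)) := by
  have hBt : Bᵀ = B := by simpa using hB.isHermitian.eq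
  have hZB (l : Fin r) : (Z l)ᵀ * B⁻¹ * Z l = (Z l)ᵀ := by
    have hGt : (G l)ᵀ = G l := by
      simp [hG, transpose_mul, transpose_nonsing_inv, hBt, Matrix.mul_assoc]
    have hP := transpose_mul_mul_of_moorePenrose hGt (hP1 l) (hP2 l) (hP3 l) (hP4 l)
    calc (Z l)ᵀ * B⁻¹ * Z l
        = Mᵀ * S l * ((P l)ᵀ * G l * P l) * (S l)ᵀ * M := by
          simp [hZ, hG, transpose_mul, Matrix.mul_assoc]
      _ = (Z l)ᵀ := by
          rw [hP]
          simp [hZ, transpose_mul, Matrix.mul_assoc]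
  have hstep (l : Fin r) : yp l - ys = (y - ys) - (B⁻¹ * Z l) *ᵥ (y - ys) := by
    rw [hyp, ← hys, ← mulVec_sub, mulVec_mulVec, hZ, sub_right_comm]
    simp only [Matrix.mul_assoc]
  have hEZv : (y - ys) ⬝ᵥ EZ *ᵥ (y - ys) = ∑ l, p l * ((y - ys) ⬝ᵥ Z l *ᵥ (y - ys)) := by
    simp [hEZ, sum_mulVec, dotProduct_sum, smul_mulVec]
  simp_rw [hstep, dotProduct_mulVec_sub_inv_mulVec hB (hZB _), mul_sub, Finset.sum_sub_distrib,
    ← Finset.sum_mul, hpsum]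
  linarith [hspec (y - ys)]
end

section
/- Convergence of sketch-and-project (Theorem 4): Let M ∈ ℝ^{m×n}, c ∈ ℝ^m, y* ∈ ℝ^n with M y* = c, and let B ∈ ℝ^{n×n} be symmetric positive definite. Let S_1,…,S_r be sketching matrices with probabilities p_l ≥ 0, ∑_l p_l = 1, let P_l satisfy the four Moore–Penrose equations for G_l = S_lᵀ M B⁻¹ Mᵀ S_l, set Z_l = Mᵀ S_l P_l S_lᵀ M and E[Z] = ∑_l p_l Z_l, and suppose λ ≥ 0 satisfies vᵀ E[Z] v ≥ λ · vᵀ B v for all v ∈ ℝ^n. Fix y^0 ∈ ℝ^n and for each sequence ω = (l_1,…,l_k) ∈ {1,…,r}^k define y^t(ω) = y^{t−1}(ω) − B⁻¹ Mᵀ S_{l_t} P_{l_t} S_{l_t}ᵀ (M y^{t−1}(ω) − c). Then ∑_{ω ∈ {1,…,r}^k} (∏_{t=1}^k p_{l_t}) · (y^k(ω) − y*)ᵀ B (y^k(ω) − y*) ≤ (1 − λ)^k (y^0 − y*)ᵀ B (y^0 − y*). -/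
open Matrix BigOperators

/-- If one random step contracts a nonnegative potential by `ρ` in expectation, then `k` independent
steps contract it by `ρ ^ k`. -/
theorem sum_prod_mul_foldl_le_s7 {α ι : Type*} [Fintype ι] (p : ι → ℝ) (hp : ∀ l, 0 ≤ p l)
    (f : α → ℝ) (hf : ∀ y, 0 ≤ f y) (step : α → ι → α) (ρ : ℝ)
    (h : ∀ y, ∑ l, p l * f (step y l) ≤ ρ * f y) (k : ℕ) (y : α) :
    ∑ ω : Fin k → ι, (∏ t, p (ω t)) * f ((List.ofFn ω).foldl step y) ≤ ρ ^ k * f y := by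
  rcases lt_or_ge ρ 0 with hρ | hρ
  · have hzero : ∀ y, f y = 0 := fun y => by
      have := (Finset.sum_nonneg fun l _ => mul_nonneg (hp l) (hf (step y l))).trans (h y)
      exact le_antisymm (nonpos_of_mul_nonneg_right this hρ) (hf y)
    simp [hzero]
  · induction k generalizing y with
    | zero => simp
    | succ k ih =>
      rw [← (Fin.consEquiv fun _ : Fin (k + 1) => ι).sum_comp, Fintype.sum_prod_type]
      simp only [Fin.consEquiv_apply, Fin.prod_univ_succ, Fin.cons_zero, Fin.cons_succ,
        List.ofFn_succ, List.foldl_cons, mul_assoc, ← Finset.mul_sum]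
      calc _ ≤ ∑ l, p l * (ρ ^ k * f (step y l)) :=
            Finset.sum_le_sum fun l _ => mul_le_mul_of_nonneg_left (ih (step y l)) (hp l)
        _ = ρ ^ k * ∑ l, p l * f (step y l) := by
            rw [Finset.mul_sum]; exact Finset.sum_congr rfl fun l _ => by ring
        _ ≤ ρ ^ k * (ρ * f y) := mul_le_mul_of_nonneg_left (h y) (pow_nonneg hρ k)
        _ = _ := by ring

/-- The Moore–Penrose pseudoinverse of a symmetric matrix is symmetric. -/
theorem transpose_eq_self_of_moorePenrose {ι : Type*} [Fintype ι] {G P : Matrix ι ι ℝ}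
    (hG : Gᵀ = G) (h1 : G * P * G = G) (h2 : P * G * P = P)
    (h3 : (G * P)ᵀ = G * P) (h4 : (P * G)ᵀ = P * G) : Pᵀ = P := by
  rw [transpose_mul, hG] at h3 h4
  have h1' : G * Pᵀ * G = G := by
    simpa [transpose_mul, hG, Matrix.mul_assoc] using congrArg transpose h1
  have h2' : Pᵀ * G * Pᵀ = Pᵀ := by
    simpa [transpose_mul, hG, Matrix.mul_assoc] using congrArg transpose h2
  have hcomm : P * G = G * P :=
    calc P * G = P * (G * Pᵀ * G) := by rw [h1']
      _ = P * G * (Pᵀ * G) := by simp only [Matrix.mul_assoc]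
      _ = G * Pᵀ * (G * P) := by rw [h3, h4]
      _ = G * Pᵀ * G * P := by simp only [Matrix.mul_assoc]
      _ = G * P := by rw [h1']
  calc Pᵀ = Pᵀ * G * Pᵀ := h2'.symm
    _ = P * G * Pᵀ := by rw [h3, hcomm]
    _ = P * (P * G) := by rw [Matrix.mul_assoc, h4]
    _ = P * G * P := by rw [hcomm, ← Matrix.mul_assoc, hcomm]
    _ = P := h2

/-- If `Z` is symmetric and `Z B⁻¹ Z = Z`, then `1 - B⁻¹ Z` is a `B`-orthogonal projection, so it
lowers the squared `B`-norm of `e` by `eᵀ Z e`. -/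
theorem quadForm_sub_inv_mul_mulVec {ι : Type*} [Fintype ι] [DecidableEq ι]
    {B Z : Matrix ι ι ℝ} (hB : Bᵀ = B) (hdet : IsUnit B.det) (hZ : Zᵀ = Z)
    (hZZ : Z * B⁻¹ * Z = Z) (e : ι → ℝ) :
    (e - (B⁻¹ * Z) *ᵥ e) ⬝ᵥ B *ᵥ (e - (B⁻¹ * Z) *ᵥ e) = e ⬝ᵥ B *ᵥ e - e ⬝ᵥ Z *ᵥ e := by
  have hBZ : B *ᵥ ((B⁻¹ * Z) *ᵥ e) = Z *ᵥ e := by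
    rw [mulVec_mulVec, ← Matrix.mul_assoc, mul_nonsing_inv B hdet, Matrix.one_mul]
  have hT : (B⁻¹ * Z)ᵀ = Z * B⁻¹ := by
    rw [transpose_mul, hZ, transpose_nonsing_inv, hB]
  have hleft : ∀ w, ((B⁻¹ * Z) *ᵥ e) ⬝ᵥ w = e ⬝ᵥ (Z * B⁻¹) *ᵥ w := fun w => by
    rw [← hT, mulVec_transpose, dotProduct_comm, dotProduct_mulVec, dotProduct_comm]
  rw [mulVec_sub, hBZ, sub_dotProduct, hleft, mulVec_sub, mulVec_mulVec, mulVec_mulVec, hZZ,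
    Matrix.mul_assoc, nonsing_inv_mul B hdet, Matrix.mul_one, sub_self, dotProduct_zero, sub_zero,
    dotProduct_sub]

/-- Convergence of sketch-and-project (Theorem 4). -/
theorem sap_convergence {m n r : ℕ} (k : ℕ)
    (M : Matrix (Fin m) (Fin n) ℝ) (c : Fin m → ℝ)
    (ys : Fin n → ℝ) (hys : M.mulVec ys = c)
    (B : Matrix (Fin n) (Fin n) ℝ) (hB : B.PosDef)
    (q : Fin r → ℕ)
    (S : ∀ l : Fin r, Matrix (Fin m) (Fin (q l)) ℝ)
    (p : Fin r → ℝ) (hp : ∀ l, 0 ≤ p l) (hpsum : ∑ l, p l = 1)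
    (P : ∀ l : Fin r, Matrix (Fin (q l)) (Fin (q l)) ℝ)
    (G : ∀ l : Fin r, Matrix (Fin (q l)) (Fin (q l)) ℝ)
    (hG : ∀ l, G l = (S l)ᵀ * M * B⁻¹ * Mᵀ * S l)
    (hP1 : ∀ l, G l * P l * G l = G l) (hP2 : ∀ l, P l * G l * P l = P l)
    (hP3 : ∀ l, (G l * P l)ᵀ = G l * P l) (hP4 : ∀ l, (P l * G l)ᵀ = P l * G l)
    (Z : ∀ l : Fin r, Matrix (Fin n) (Fin n) ℝ)
    (hZ : ∀ l, Z l = Mᵀ * S l * P l * (S l)ᵀ * M)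
    (EZ : Matrix (Fin n) (Fin n) ℝ) (hEZ : EZ = ∑ l, p l • Z l)
    (lam : ℝ) (hlam : 0 ≤ lam)
    (hspec : ∀ v : Fin n → ℝ, lam * (v ⬝ᵥ B.mulVec v) ≤ v ⬝ᵥ EZ.mulVec v)
    (y0 : Fin n → ℝ)
    (step : (Fin n → ℝ) → Fin r → (Fin n → ℝ))
    (hstep : ∀ y l, step y l = y - (B⁻¹ * Mᵀ * S l * P l * (S l)ᵀ).mulVec (M.mulVec y - c)) :
    ∑ ω : Fin k → Fin r,
        (∏ t, p (ω t)) *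
          (((List.ofFn ω).foldl step y0 - ys) ⬝ᵥ B.mulVec ((List.ofFn ω).foldl step y0 - ys))
      ≤ (1 - lam) ^ k * ((y0 - ys) ⬝ᵥ B.mulVec (y0 - ys)) := by
  have hBT : Bᵀ = B := by simpa using hB.isHermitian.eq
  have hdet : IsUnit B.det := hB.det_pos.ne'.isUnit
  have hPT : ∀ l, (P l)ᵀ = P l := fun l => by
    refine transpose_eq_self_of_moorePenrose ?_ (hP1 l) (hP2 l) (hP3 l) (hP4 l)
    simp only [hG, transpose_mul, transpose_transpose, transpose_nonsing_inv, hBT,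
      Matrix.mul_assoc]
  have hZT : ∀ l, (Z l)ᵀ = Z l := fun l => by
    simp only [hZ, transpose_mul, transpose_transpose, hPT, Matrix.mul_assoc]
  have hZZ : ∀ l, Z l * B⁻¹ * Z l = Z l := fun l =>
    calc Z l * B⁻¹ * Z l = Mᵀ * S l * (P l * G l * P l) * (S l)ᵀ * M := by
          simp only [hZ, hG, Matrix.mul_assoc]
      _ = Z l := by rw [hP2, hZ]
  have herr : ∀ y l, step y l - ys = (y - ys) - (B⁻¹ * Z l) *ᵥ (y - ys) := fun y l => by
    rw [hstep, ← hys, ← mulVec_sub, mulVec_mulVec, hZ, sub_right_comm]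
    simp only [Matrix.mul_assoc]
  refine sum_prod_mul_foldl_le_s7 p hp (fun y => (y - ys) ⬝ᵥ B *ᵥ (y - ys))
    (fun y => by simpa using hB.posSemidef.dotProduct_mulVec_nonneg (y - ys)) step (1 - lam)
    (fun y => ?_) k y0
  have hE : (y - ys) ⬝ᵥ EZ *ᵥ (y - ys) = ∑ l, p l * ((y - ys) ⬝ᵥ Z l *ᵥ (y - ys)) := by
    simp only [hEZ, sum_mulVec, dotProduct_sum, smul_mulVec, dotProduct_smul, smul_eq_mul]
  have hspec_y := hspec (y - ys)
  simp only [herr, quadForm_sub_inv_mul_mulVec hBT hdet (hZT _) (hZZ _), mul_sub,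
    Finset.sum_sub_distrib, ← Finset.sum_mul, hpsum, ← hE]
  linarith
end

section
/- Closed form of the SAP-REK(ε) update: Let A ∈ ℝ^{m×n}, b ∈ ℝ^m, ε > 0, i ∈ {1,…,m}, j ∈ {1,…,n} with A_{:j} ≠ 0. Let M = [[Aᵀ,0],[I_m,A]], B_ε = diag(I_m, εI_n), S = diag(I_{:j}, I_{:i}), c = (0;b), and set d = ‖A_{:j}‖²(1 + (1/ε)‖A_{i:}‖²) − A_{ij}². Then for every (z; x) ∈ ℝ^{m+n}, the SAP update (z;x) − B_ε⁻¹ Mᵀ S (Sᵀ M B_ε⁻¹ Mᵀ S)⁻¹ Sᵀ(M(z;x) − c) equals (z;x) − (1/d) · K · (A_{:j}ᵀ z ; z_i + A_{i:}x − b_i), where K is the block matrix with blocks K₁₁ = (1 + (1/ε)‖A_{i:}‖²) A_{:j} − A_{ij} I_{:i}, K₁₂ = −A_{ij} A_{:j} + ‖A_{:j}‖² I_{:i} (both columns in ℝ^m), K₂₁ = −(1/ε) A_{ij} A_{i:}ᵀ, K₂₂ = (1/ε) ‖A_{:j}‖² A_{i:}ᵀ (both columns in ℝ^n). -/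
open Matrix BigOperators

/-- The determinant of the sketched Gram matrix is positive: one row and one column of a matrix,
with the column nonzero. -/
theorem sketched_det_pos {m n : Type*} [Fintype m] [Fintype n] (A : Matrix m n ℝ) {ε : ℝ}
    (hε : 0 < ε) (i : m) (j : n) (hj : (fun l => A l j) ≠ 0) :
    0 < (∑ l, A l j ^ 2) * (1 + (1 / ε) * ∑ l, A i l ^ 2) - A i j ^ 2 := by
  obtain ⟨k, hk⟩ := Function.ne_iff.mp hj
  have hcol (l : m) : A l j ^ 2 ≤ ∑ l, A l j ^ 2 :=
    Finset.single_le_sum (f := fun l => A l j ^ 2) (fun _ _ => sq_nonneg _) (Finset.mem_univ l)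
  have hrow : A i j ^ 2 ≤ ∑ l, A i l ^ 2 :=
    Finset.single_le_sum (f := fun l => A i l ^ 2) (fun _ _ => sq_nonneg _) (Finset.mem_univ j)
  have hs : 0 < ∑ l, A l j ^ 2 := (sq_pos_of_ne_zero hk).trans_le (hcol k)
  have hi := hcol i
  rcases eq_or_ne (A i j) 0 with h | h
  · rw [h]
    have : 0 ≤ ∑ l, A i l ^ 2 := (sq_nonneg _).trans hrow
    have : 0 < (∑ l, A l j ^ 2) * (1 + (1 / ε) * ∑ l, A i l ^ 2) := by positivity
    linarith
  · have hr : 0 < ∑ l, A i l ^ 2 := lt_of_lt_of_le (by positivity) hrow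
    have : 0 < (∑ l, A l j ^ 2) * ((1 / ε) * ∑ l, A i l ^ 2) := by positivity
    linarith

/-- Closed form of the SAP-REK(ε) update. -/
theorem saprek_update_closed_form {m n : ℕ}
    (A : Matrix (Fin m) (Fin n) ℝ) (b : Fin m → ℝ) (ε : ℝ) (hε : 0 < ε)
    (i : Fin m) (j : Fin n)
    (hj : (fun l => A l j) ≠ 0)
    (M : Matrix (Fin n ⊕ Fin m) (Fin m ⊕ Fin n) ℝ)
    (hM : M = Matrix.fromBlocks Aᵀ 0 (1 : Matrix (Fin m) (Fin m) ℝ) A)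
    (B : Matrix (Fin m ⊕ Fin n) (Fin m ⊕ Fin n) ℝ)
    (hB : B = Matrix.fromBlocks (1 : Matrix (Fin m) (Fin m) ℝ) 0 0
      (ε • (1 : Matrix (Fin n) (Fin n) ℝ)))
    (S : Matrix (Fin n ⊕ Fin m) (Unit ⊕ Unit) ℝ)
    (hS : S = Matrix.fromBlocks
      (Matrix.of fun l (_ : Unit) => if l = j then (1 : ℝ) else 0) 0 0
      (Matrix.of fun l (_ : Unit) => if l = i then (1 : ℝ) else 0))
    (c : Fin n ⊕ Fin m → ℝ) (hc : c = Sum.elim (0 : Fin n → ℝ) b)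
    (d : ℝ)
    (hd : d = (∑ l, A l j ^ 2) * (1 + (1 / ε) * ∑ l, A i l ^ 2) - A i j ^ 2)
    (K : Matrix (Fin m ⊕ Fin n) (Unit ⊕ Unit) ℝ)
    (hK : K = Matrix.fromBlocks
      (Matrix.of fun l (_ : Unit) =>
        (1 + (1 / ε) * ∑ l', A i l' ^ 2) * A l j - A i j * (if l = i then (1:ℝ) else 0))
      (Matrix.of fun l (_ : Unit) =>
        -(A i j) * A l j + (∑ l', A l' j ^ 2) * (if l = i then (1:ℝ) else 0))
      (Matrix.of fun l (_ : Unit) => -(1 / ε) * A i j * A i l)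
      (Matrix.of fun l (_ : Unit) => (1 / ε) * (∑ l', A l' j ^ 2) * A i l))
    (z : Fin m → ℝ) (x : Fin n → ℝ) :
    Sum.elim z x
        - (B⁻¹ * Mᵀ * S * (Sᵀ * M * B⁻¹ * Mᵀ * S)⁻¹ * Sᵀ).mulVec
            (M.mulVec (Sum.elim z x) - c)
      = Sum.elim z x
        - (1 / d) • K.mulVec
            (Sum.elim (fun _ : Unit => ∑ l, A l j * z l)
              (fun _ : Unit => z i + (∑ l, A i l * x l) - b i)) := by
  have hdpos : 0 < d := hd ▸ sketched_det_pos A hε i j hj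
  have hd0 : d ≠ 0 := hdpos.ne'
  have hε0 : ε ≠ 0 := hε.ne'
  have hBinv : B⁻¹ = Matrix.fromBlocks 1 0 0 (ε⁻¹ • 1) := by
    apply Matrix.inv_eq_right_inv
    rw [hB, Matrix.fromBlocks_multiply]
    simp [smul_smul, hε0]
  have hP : B⁻¹ * Mᵀ * S = Matrix.fromBlocks (Matrix.of fun l (_ : Unit) => A l j)
      (Matrix.of fun l (_ : Unit) => if l = i then (1 : ℝ) else 0) 0
      (Matrix.of fun l (_ : Unit) => ε⁻¹ * A i l) := by
    rw [hBinv, hM, hS, Matrix.fromBlocks_transpose, Matrix.fromBlocks_multiply,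
      Matrix.fromBlocks_multiply]
    congr 1 <;> ext l u <;> simp [Matrix.mul_apply]
  have hQ : Sᵀ * M = Matrix.fromBlocks (Matrix.of fun (_ : Unit) l => A l j) 0
      (Matrix.of fun (_ : Unit) l => if l = i then (1 : ℝ) else 0)
      (Matrix.of fun (_ : Unit) l => A i l) := by
    rw [hM, hS, Matrix.fromBlocks_transpose, Matrix.fromBlocks_multiply]
    congr 1 <;> ext u l <;> simp [Matrix.mul_apply, eq_comm]
  have hG : (Sᵀ * M * B⁻¹ * Mᵀ * S)⁻¹ = d⁻¹ • Matrix.fromBlocks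
      (Matrix.of fun (_ _ : Unit) => 1 + (1 / ε) * ∑ l, A i l ^ 2)
      (Matrix.of fun (_ _ : Unit) => -A i j) (Matrix.of fun (_ _ : Unit) => -A i j)
      (Matrix.of fun (_ _ : Unit) => ∑ l, A l j ^ 2) := by
    have hassoc : Sᵀ * M * B⁻¹ * Mᵀ * S = (Sᵀ * M) * (B⁻¹ * Mᵀ * S) := by
      simp only [Matrix.mul_assoc]
    have hGram : Sᵀ * M * B⁻¹ * Mᵀ * S = Matrix.fromBlocks
        (Matrix.of fun (_ _ : Unit) => ∑ l, A l j ^ 2)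
        (Matrix.of fun (_ _ : Unit) => A i j) (Matrix.of fun (_ _ : Unit) => A i j)
        (Matrix.of fun (_ _ : Unit) => 1 + (1 / ε) * ∑ l, A i l ^ 2) := by
      rw [hassoc, hQ, hP, Matrix.fromBlocks_multiply]
      congr 1 <;> ext u v <;>
        simp [Matrix.mul_apply, sq, Finset.mul_sum, mul_left_comm]
    apply Matrix.inv_eq_right_inv
    rw [hGram, Matrix.mul_smul, Matrix.fromBlocks_multiply, Matrix.fromBlocks_smul,
      ← Matrix.fromBlocks_one]
    congr 1 <;> ext u v <;> simp only [Matrix.smul_apply, Matrix.add_apply, Matrix.mul_apply,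
      Matrix.of_apply, Finset.univ_unique, Finset.sum_singleton, smul_eq_mul, Matrix.one_apply_eq,
      Matrix.zero_apply]
    · rw [inv_mul_eq_one₀ hd0, hd]
      ring
    · ring
    · ring
    · rw [inv_mul_eq_one₀ hd0, hd]
      ring
  have hPG : B⁻¹ * Mᵀ * S * (Sᵀ * M * B⁻¹ * Mᵀ * S)⁻¹ = (1 / d) • K := by
    rw [hG, hP, hK, Matrix.mul_smul, Matrix.fromBlocks_multiply, one_div d]
    congr 2 <;> ext l u <;> simp [Matrix.mul_apply] <;> ring
  have hres : Sᵀ.mulVec (M.mulVec (Sum.elim z x) - c)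
      = Sum.elim (fun _ : Unit => ∑ l, A l j * z l)
          (fun _ : Unit => z i + (∑ l, A i l * x l) - b i) := by
    rw [Matrix.mulVec_sub, Matrix.mulVec_mulVec, hQ, hS, hc, Matrix.fromBlocks_transpose,
      Matrix.fromBlocks_mulVec, Matrix.fromBlocks_mulVec]
    funext u
    rcases u with u | u <;> simp [Matrix.mulVec, dotProduct]
  rw [← Matrix.mulVec_mulVec, hres, hPG, Matrix.smul_mulVec]
end

section
/- REK is the ε → 0 limit of the SAP-REK(ε) update: Let A ∈ ℝ^{m×n}, b ∈ ℝ^m, i ∈ {1,…,m}, j ∈ {1,…,n} with A_{i:} ≠ 0 and A_{:j} ≠ 0, and fix (z; x) ∈ ℝ^{m+n}. For ε > 0 let (z^ε; x^ε) = (z;x) − (1/d_ε) K_ε (A_{:j}ᵀ z ; z_i + A_{i:}x − b_i) be the SAP-REK(ε) update, where d_ε = ‖A_{:j}‖²(1 + (1/ε)‖A_{i:}‖²) − A_{ij}² and K_ε has blocks K₁₁ = (1 + (1/ε)‖A_{i:}‖²) A_{:j} − A_{ij} I_{:i}, K₁₂ = −A_{ij} A_{:j} + ‖A_{:j}‖²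 I_{:i}, K₂₁ = −(1/ε) A_{ij} A_{i:}ᵀ, K₂₂ = (1/ε)‖A_{:j}‖² A_{i:}ᵀ. Then as ε → 0 from the right, (z^ε; x^ε) tends to (z⁺; x⁺), where z⁺ = z − (A_{:j}ᵀ z/‖A_{:j}‖²) A_{:j} and x⁺ = x − ((A_{i:}x − b_i + z⁺_i)/‖A_{i:}‖²) A_{i:}ᵀ is precisely the REK update. -/
open Matrix BigOperators

/-- For `ε > 0`, the SAP-REK(ε) update of the stacked iterate `(z; x)`. -/
noncomputable def saprekUpdate {m n : ℕ} (A : Matrix (Fin m) (Fin n) ℝ) (b : Fin m → ℝ)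
    (i : Fin m) (j : Fin n) (z : Fin m → ℝ) (x : Fin n → ℝ) (ε : ℝ) :
    Fin m ⊕ Fin n → ℝ :=
  let d : ℝ := (∑ l, A l j ^ 2) * (1 + (1 / ε) * ∑ l, A i l ^ 2) - A i j ^ 2
  let K : Matrix (Fin m ⊕ Fin n) (Unit ⊕ Unit) ℝ := Matrix.fromBlocks
    (Matrix.of fun l (_ : Unit) =>
      (1 + (1 / ε) * ∑ l', A i l' ^ 2) * A l j - A i j * (if l = i then (1:ℝ) else 0))
    (Matrix.of fun l (_ : Unit) =>
      -(A i j) * A l j + (∑ l', A l' j ^ 2) * (if l = i then (1:ℝ) else 0))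
    (Matrix.of fun l (_ : Unit) => -(1 / ε) * A i j * A i l)
    (Matrix.of fun l (_ : Unit) => (1 / ε) * (∑ l', A l' j ^ 2) * A i l)
  Sum.elim z x
    - (1 / d) • K.mulVec
        (Sum.elim (fun _ : Unit => ∑ l, A l j * z l)
          (fun _ : Unit => z i + (∑ l, A i l * x l) - b i))

/-- The sum of the squares of the entries of a nonzero real vector is nonzero. -/
theorem sum_sq_ne_zero_of_ne_zero {ι : Type*} [Fintype ι] {v : ι → ℝ} (hv : v ≠ 0) :
    ∑ l, v l ^ 2 ≠ 0 := by
  intro h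
  apply hv
  funext l
  simpa using (Finset.sum_eq_zero_iff_of_nonneg (fun k _ => sq_nonneg (v k))).1 h l
    (Finset.mem_univ l)

/-- A quotient of affine functions of `1 / ε` tends to the quotient of the leading coefficients. -/
theorem tendsto_affine_inv_div_affine_inv (p q r s : ℝ) (hs : s ≠ 0) :
    Filter.Tendsto (fun ε : ℝ => (p + 1 / ε * q) / (r + 1 / ε * s))
      (nhdsWithin 0 (Set.Ioi 0)) (nhds (q / s)) := by
  have hcont : ContinuousAt (fun ε : ℝ => (ε * p + q) / (ε * r + s)) 0 :=
    ContinuousAt.div (by fun_prop) (by fun_prop) (by simpa using hs)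
  have hlim := hcont.tendsto.mono_left (nhdsWithin_le_nhds (s := Set.Ioi 0))
  simp only [zero_mul, zero_add] at hlim
  refine hlim.congr' ?_
  filter_upwards [self_mem_nhdsWithin] with ε hε
  have hε' : ε ≠ 0 := ne_of_gt hε
  rw [← mul_div_mul_left (p + 1 / ε * q) (r + 1 / ε * s) hε']
  congr 1 <;> field_simp

/-- REK is the ε → 0 limit of the SAP-REK(ε) update. -/
theorem rek_is_limit_of_saprek {m n : ℕ}
    (A : Matrix (Fin m) (Fin n) ℝ) (b : Fin m → ℝ)
    (i : Fin m) (j : Fin n)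
    (hi : A i ≠ 0) (hj : (fun l => A l j) ≠ 0)
    (z : Fin m → ℝ) (x : Fin n → ℝ)
    (zp : Fin m → ℝ)
    (hzp : zp = z - ((∑ l, A l j * z l) / (∑ l, A l j ^ 2)) • (fun l => A l j))
    (xp : Fin n → ℝ)
    (hxp : xp = x - (((∑ l, A i l * x l) - b i + zp i) / (∑ l, A i l ^ 2)) • A i) :
    Filter.Tendsto (saprekUpdate A b i j z x)
      (nhdsWithin 0 (Set.Ioi (0 : ℝ))) (nhds (Sum.elim zp xp)) := by
  have hR : ∑ l, A i l ^ 2 ≠ 0 := sum_sq_ne_zero_of_ne_zero hi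
  have hC : ∑ l, A l j ^ 2 ≠ 0 := sum_sq_ne_zero_of_ne_zero hj
  rw [tendsto_pi_nhds]
  subst hxp hzp
  generalize hRdef : ∑ l, A i l ^ 2 = R at *
  generalize hCdef : ∑ l, A l j ^ 2 = C at *
  rintro (l | l)
  · set u := ∑ k, A k j * z k with hu
    set v := z i + (∑ k, A i k * x k) - b i with hv
    set δ : ℝ := if l = i then 1 else 0 with hδ
    convert (tendsto_affine_inv_div_affine_inv
      ((A l j - A i j * δ) * u + (-A i j * A l j + C * δ) * v) (R * A l j * u)
      (C - A i j ^ 2) (C * R) (mul_ne_zero hC hR)).const_sub (z l) using 1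
    · funext ε
      simp [saprekUpdate, Matrix.mulVec, dotProduct, hRdef, hCdef, ← hu, ← hv, ← hδ, -mul_ite]
      ring
    · congr 1
      simp
      field_simp
  · set u := ∑ k, A k j * z k with hu
    set v := z i + (∑ k, A i k * x k) - b i with hv
    convert (tendsto_affine_inv_div_affine_inv 0 (-A i j * A i l * u + C * A i l * v)
      (C - A i j ^ 2) (C * R) (mul_ne_zero hC hR)).const_sub (x l) using 1
    · funext ε
      simp [saprekUpdate, Matrix.mulVec, dotProduct, hRdef, hCdef, ← hu, ← hv]
      ring
    · congr 1
      simp [hv]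
      field_simp
      ring
end

section
/- Expectation identity for the modified SAP-REK(ε) matrix: Let A ∈ ℝ^{m×n} have every row and every column nonzero and let ε > 0. Set p_i = (1 + (1/ε)‖A_{i:}‖²)/(m + (1/ε)‖A‖_F²) and q_j = ‖A_{:j}‖²/‖A‖_F². For each i, j let W(i,j) be the (m+n)×(m+n) block matrix (1/(‖A_{:j}‖²(1 + (1/ε)‖A_{i:}‖²))) · [[(1 + (1/ε)‖A_{i:}‖²) A_{:j}A_{:j}ᵀ − A_{ij} A_{:j} I_{i:} − A_{ij} I_{:i} A_{:j}ᵀ + ‖A_{:j}‖² I_{:i} I_{i:}, (1/√ε)(−A_{ij} A_{:j} A_{i:} + ‖A_{:j}‖² I_{:i} A_{i:})],[(1/√ε)(−A_{ij} A_{i:}ᵀ A_{:j}ᵀ + ‖A_{:j}‖² A_{i:}ᵀ I_{i:}), (1/ε) ‖A_{:j}‖² A_{i:}ᵀ A_{i:}]]. Then ∑_{i=1}^m ∑_{j=1}^n p_i q_j W(i,j) = (1/(m + (1/ε)‖A‖_F²)) · [[((m − 2 + (1/ε)‖A‖_F²)/‖A‖_F²) A Aᵀ + I_m, (1/√ε)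 A (I_n − AᵀA/‖A‖_F²)],[(1/√ε)(I_n − AᵀA/‖A‖_F²) Aᵀ, (1/ε) Aᵀ A]]. -/
open Matrix BigOperators

/-- Expectation identity for the modified SAP-REK(ε) matrix. -/
theorem saprek_expectation_identity {m n : ℕ}
    (A : Matrix (Fin m) (Fin n) ℝ) (ε : ℝ) (hε : 0 < ε)
    (hrows : ∀ i, A i ≠ 0)
    (hcols : ∀ j, (fun l => A l j) ≠ 0)
    (F : ℝ) (hF : F = ∑ i, ∑ l, A i l ^ 2)
    (p : Fin m → ℝ)
    (hp : ∀ i, p i = (1 + (1 / ε) * ∑ l, A i l ^ 2) / ((m : ℝ) + (1 / ε) * F))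
    (q : Fin n → ℝ)
    (hq : ∀ j, q j = (∑ l, A l j ^ 2) / F)
    (W : Fin m → Fin n → Matrix (Fin m ⊕ Fin n) (Fin m ⊕ Fin n) ℝ)
    (hW : ∀ i j, W i j =
      (1 / ((∑ l, A l j ^ 2) * (1 + (1 / ε) * ∑ l, A i l ^ 2))) •
        Matrix.fromBlocks
          (Matrix.of fun l l' =>
            (1 + (1 / ε) * ∑ l'', A i l'' ^ 2) * A l j * A l' j
              - A i j * A l j * (if l' = i then (1:ℝ) else 0)
              - A i j * (if l = i then (1:ℝ) else 0) * A l' j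
              + (∑ l'', A l'' j ^ 2) * (if l = i then (1:ℝ) else 0)
                  * (if l' = i then (1:ℝ) else 0))
          (Matrix.of fun l l' =>
            (1 / Real.sqrt ε) * (-(A i j) * A l j * A i l'
              + (∑ l'', A l'' j ^ 2) * (if l = i then (1:ℝ) else 0) * A i l'))
          (Matrix.of fun l l' =>
            (1 / Real.sqrt ε) * (-(A i j) * A i l * A l' j
              + (∑ l'', A l'' j ^ 2) * A i l * (if l' = i then (1:ℝ) else 0)))
          (Matrix.of fun l l' =>
            (1 / ε) * (∑ l'', A l'' j ^ 2) * A i l * A i l')) :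
    ∑ i, ∑ j, (p i * q j) • W i j
      = (1 / ((m : ℝ) + (1 / ε) * F)) •
          Matrix.fromBlocks
            ((((m : ℝ) - 2 + (1 / ε) * F) / F) • (A * Aᵀ)
              + (1 : Matrix (Fin m) (Fin m) ℝ))
            ((1 / Real.sqrt ε) •
              (A * ((1 : Matrix (Fin n) (Fin n) ℝ) - (1 / F) • (Aᵀ * A))))
            ((1 / Real.sqrt ε) •
              (((1 : Matrix (Fin n) (Fin n) ℝ) - (1 / F) • (Aᵀ * A)) * Aᵀ))
            ((1 / ε) • (Aᵀ * A)) := by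
  have hrow_pos : ∀ i, 0 < 1 + (1 / ε) * ∑ l, A i l ^ 2 := fun i => by positivity
  have hcol_ne : ∀ j, (∑ l, A l j ^ 2) ≠ 0 := fun j h => hcols j <| by
    ext l
    simpa using (Finset.sum_eq_zero_iff_of_nonneg fun l _ => sq_nonneg (A l j)).1 h l
      (Finset.mem_univ l)
  rcases isEmpty_or_nonempty (Fin m) with hm | ⟨⟨i₀⟩⟩
  · have hn : IsEmpty (Fin n) := ⟨fun j => hcol_ne j (by simp)⟩
    exact Subsingleton.elim _ _
  have hF_pos : 0 < F := by
    obtain ⟨l, hl⟩ := Function.ne_iff.1 (hrows i₀)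
    rw [hF]
    refine Finset.sum_pos' (fun i _ => by positivity) ⟨i₀, Finset.mem_univ _, ?_⟩
    exact Finset.sum_pos' (fun l _ => by positivity) ⟨l, Finset.mem_univ _, sq_pos_of_ne_zero hl⟩
  have hD_pos : 0 < (m : ℝ) + (1 / ε) * F := by positivity
  have hcoeff : ∀ i j, p i * q j *
      (1 / ((∑ l, A l j ^ 2) * (1 + (1 / ε) * ∑ l, A i l ^ 2))) =
        (1 / ((m : ℝ) + (1 / ε) * F)) * (1 / F) := fun i j => by
    have hr := (hrow_pos i).ne'
    have hc := hcol_ne j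
    rw [hp, hq]
    generalize 1 + (1 / ε) * ∑ l, A i l ^ 2 = r at hr ⊢
    generalize ∑ l, A l j ^ 2 = c at hc ⊢
    generalize (m : ℝ) + (1 / ε) * F = D at hD_pos ⊢
    field_simp
  have hcols_sum : ∑ j, ∑ l, A l j ^ 2 = F := by rw [hF, Finset.sum_comm]
  have hrows_sum : ∑ i, (1 + (1 / ε) * ∑ l, A i l ^ 2) = (m : ℝ) + (1 / ε) * F := by
    simp [Finset.sum_add_distrib, ← Finset.mul_sum, hF]
  simp_rw [hW, smul_smul, hcoeff, ← Finset.smul_sum, mul_smul]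
  congr 1
  ext (l | l) (l' | l') <;>
    simp only [Matrix.smul_apply, Matrix.sum_apply, Matrix.fromBlocks_apply₁₁,
      Matrix.fromBlocks_apply₁₂, Matrix.fromBlocks_apply₂₁, Matrix.fromBlocks_apply₂₂,
      Matrix.of_apply, Matrix.add_apply, smul_eq_mul]
  · have h₁ : ∑ i, ∑ j, (1 + (1 / ε) * ∑ l'', A i l'' ^ 2) * A l j * A l' j =
        ((m : ℝ) + (1 / ε) * F) * (A * Aᵀ) l l' := by
      rw [← hrows_sum, Matrix.mul_apply, Finset.sum_mul_sum]
      simp only [Matrix.transpose_apply, mul_assoc]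
    have h₂ : ∑ i, ∑ j, A i j * A l j * (if l' = i then (1 : ℝ) else 0) = (A * Aᵀ) l l' := by
      simp [Matrix.mul_apply, mul_comm]
    have h₃ : ∑ i, ∑ j, A i j * (if l = i then (1 : ℝ) else 0) * A l' j = (A * Aᵀ) l l' := by
      rw [Finset.sum_comm]
      simp [Matrix.mul_apply]
    have h₄ : ∑ i, ∑ j, (∑ l'', A l'' j ^ 2) * (if l = i then (1 : ℝ) else 0) *
        (if l' = i then (1 : ℝ) else 0) = F * (1 : Matrix (Fin m) (Fin m) ℝ) l l' := by
      simp_rw [← Finset.sum_mul, hcols_sum]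
      simp [Matrix.one_apply]
    simp_rw [Finset.sum_add_distrib, Finset.sum_sub_distrib, h₁, h₂, h₃, h₄]
    field_simp
    ring
  · have h₁ : ∑ i, ∑ j, A i j * A l j * A i l' = (A * (Aᵀ * A)) l l' := by
      rw [← Matrix.mul_assoc, Matrix.mul_apply]
      simp [Matrix.mul_apply, Finset.mul_sum, mul_comm, mul_left_comm]
    have h₂ : ∑ i, ∑ j, (∑ l'', A l'' j ^ 2) * (if l = i then (1 : ℝ) else 0) * A i l' =
        F * A l l' := by
      simp_rw [← Finset.sum_mul, hcols_sum]
      simp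
    simp_rw [← Finset.mul_sum, Finset.sum_add_distrib, neg_mul, Finset.sum_neg_distrib, h₁, h₂,
      Matrix.mul_sub, Matrix.mul_one, Matrix.mul_smul, Matrix.sub_apply, Matrix.smul_apply,
      smul_eq_mul]
    field_simp
    ring
  · have h₁ : ∑ i, ∑ j, A i j * A i l * A l' j = (Aᵀ * A * Aᵀ) l l' := by
      rw [Matrix.mul_assoc, Matrix.mul_apply]
      simp [Matrix.mul_apply, Finset.mul_sum, mul_comm, mul_left_comm]
    have h₂ : ∑ i, ∑ j, (∑ l'', A l'' j ^ 2) * A i l * (if l' = i then (1 : ℝ) else 0) =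
        F * A l' l := by
      simp_rw [← Finset.sum_mul, hcols_sum]
      simp
    simp_rw [← Finset.mul_sum, Finset.sum_add_distrib, neg_mul, Finset.sum_neg_distrib, h₁, h₂,
      Matrix.sub_mul, Matrix.one_mul, Matrix.smul_mul, Matrix.sub_apply, Matrix.smul_apply,
      Matrix.transpose_apply, smul_eq_mul]
    field_simp
    ring
  · simp_rw [← Finset.sum_mul, ← Finset.mul_sum, hcols_sum, mul_assoc, ← Finset.mul_sum,
      Matrix.mul_apply, Matrix.transpose_apply]
    field_simp
end

section
/- Positivity and monotonicity of the smaller eigenvalue: For μ ≥ 1 real, ε > 0, and σ ∈ (0, 1], define λ₋(σ) = ((μ − 2 + 2/ε)σ² + 1)/(2(μ + 1/ε)) − (1/(μ + 1/ε)) √( (((μ − 2 + 2/ε)σ² + 1)²)/4 − (1/ε)σ⁴((μ + 1/ε) − σ²) ). Then λ₋(σ) > 0 for every σ ∈ (0, 1], and λ₋ is monotone nondecreasing in σ on (0, 1]: if 0 < σ₁ ≤ σ₂ ≤ 1 then λ₋(σ₁) ≤ λ₋(σ₂). -/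
open BigOperators

/-- The discriminant of the symmetric block, written as a sum of squares. -/
lemma block_discriminant_eq (μ e s : ℝ) :
    ((μ - 2 + 2 * e) * s + 1) ^ 2 / 4 - e * s ^ 2 * ((μ + e) - s)
      = (((μ - 2) * s + 1) / 2) ^ 2 + e * s * (1 - s) ^ 2 := by
  ring

/-- If `e * u` is a root of the characteristic polynomial at `r` lying below the diagonal entry
`e * r`, then the characteristic polynomial at any `s ∈ [r, 1]` is nonnegative at `e * u`.
After division by `s - u` this is concavity in `s`, between `r` and `1`. -/
lemma block_charpoly_nonneg {μ e u r s : ℝ} (hμ : 1 ≤ μ) (he : 0 < e) (hu : 0 < u)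
    (hur : u < r) (hr : r < 1) (hrs : r ≤ s) (hs : s ≤ 1)
    (hroot : (r - u) * ((μ - 2 + e) * r + 1 - e * u) - r * (1 - r) ^ 2 = 0) :
    0 ≤ (s - u) * ((μ - 2 + e) * s + 1 - e * u) - s * (1 - s) ^ 2 := by
  have key : (1 - r) * (r - u) * ((s - u) * ((μ - 2 + e) * s + 1 - e * u) - s * (1 - s) ^ 2)
      = (1 - s) * (s - u) * ((r - u) * ((μ - 2 + e) * r + 1 - e * u) - r * (1 - r) ^ 2)
        + (s - r) * (s - u) * (r - u) * ((μ - 1) + e * (1 - u))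
        + (1 - r) * (s - r) * (1 - s) * ((s - u) * (r - u) + u * (1 - u)) := by
    ring
  have h1 : 0 < 1 - r := by linarith
  have h2 : 0 < r - u := by linarith
  have h3 : 0 < s - u := by linarith
  have h4 : 0 ≤ s - r := by linarith
  have h5 : 0 ≤ 1 - s := by linarith
  have h6 : 0 ≤ μ - 1 := by linarith
  have h7 : 0 < 1 - u := by linarith
  refine nonneg_of_mul_nonneg_right (b := _) (a := (1 - r) * (r - u)) ?_ (by positivity)
  rw [key, hroot]
  positivity

/-- The smaller root of the characteristic polynomial of the (unnormalized) block is positive. -/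
lemma block_smaller_root_pos {μ e s : ℝ} (hμ : 1 ≤ μ) (he : 0 < e) (hs0 : 0 < s) (hs : s ≤ 1) :
    0 < ((μ - 2 + 2 * e) * s + 1) / 2
      - √(((μ - 2 + 2 * e) * s + 1) ^ 2 / 4 - e * s ^ 2 * ((μ + e) - s)) := by
  have hT : 0 < (μ - 2 + 2 * e) * s + 1 := by
    nlinarith [mul_pos he hs0, mul_nonneg (sub_nonneg.2 hμ) hs0.le]
  have hD : 0 < e * s ^ 2 * ((μ + e) - s) := by
    have : 0 < (μ + e) - s := by linarith
    positivity
  rw [sub_pos, Real.sqrt_lt' (by linarith)]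
  linarith

/-- The smaller root of the characteristic polynomial of the (unnormalized) block is monotone. -/
lemma block_smaller_root_mono {μ e r s : ℝ} (hμ : 1 ≤ μ) (he : 0 < e) (hr0 : 0 < r)
    (hrs : r ≤ s) (hs : s ≤ 1) :
    ((μ - 2 + 2 * e) * r + 1) / 2
        - √(((μ - 2 + 2 * e) * r + 1) ^ 2 / 4 - e * r ^ 2 * ((μ + e) - r))
      ≤ ((μ - 2 + 2 * e) * s + 1) / 2
        - √(((μ - 2 + 2 * e) * s + 1) ^ 2 / 4 - e * s ^ 2 * ((μ + e) - s)) := by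
  rcases hrs.eq_or_lt with rfl | hlt
  · exact le_rfl
  have hr : r < 1 := by linarith
  have hpos := block_smaller_root_pos hμ he hr0 hr.le
  have hb : 0 < e * r * (1 - r) ^ 2 := by
    have : 0 < 1 - r := by linarith
    positivity
  have hdisc := block_discriminant_eq μ e r
  have hsq := Real.sq_sqrt (show 0 ≤ ((μ - 2 + 2 * e) * r + 1) ^ 2 / 4
    - e * r ^ 2 * ((μ + e) - r) by rw [hdisc]; positivity)
  have hlow : ((μ - 2) * r + 1) / 2
      < √(((μ - 2 + 2 * e) * r + 1) ^ 2 / 4 - e * r ^ 2 * ((μ + e) - r)) := by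
    apply Real.lt_sqrt_of_sq_lt
    linarith
  set w := √(((μ - 2 + 2 * e) * r + 1) ^ 2 / 4 - e * r ^ 2 * ((μ + e) - r))
  obtain ⟨u, hu⟩ : ∃ u, ((μ - 2 + 2 * e) * r + 1) / 2 - w = e * u :=
    ⟨(((μ - 2 + 2 * e) * r + 1) / 2 - w) / e, by field_simp⟩
  have hw : w = ((μ - 2 + 2 * e) * r + 1) / 2 - e * u := by linarith
  rw [hu] at hpos ⊢
  have hu0 : 0 < u := pos_of_mul_pos_right hpos he.le
  have hur : u < r := lt_of_mul_lt_mul_left (by linarith : e * u < e * r) he.le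
  have hroot : (r - u) * ((μ - 2 + e) * r + 1 - e * u) - r * (1 - r) ^ 2 = 0 := by
    rw [hw] at hsq
    refine (mul_eq_zero.1 (?_ : e * _ = 0)).resolve_left he.ne'
    linear_combination hsq
  have hP := block_charpoly_nonneg hμ he hu0 hur hr hrs hs hroot
  have hus : 0 < s - u := by linarith
  have ha : 0 ≤ (μ - 2 + e) * s + 1 - e * u := by
    have : 0 ≤ s * (1 - s) ^ 2 := mul_nonneg (by linarith) (sq_nonneg _)
    exact nonneg_of_mul_nonneg_right (by linarith) hus
  have hes : 0 < e * (s - u) := mul_pos he hus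
  rw [le_sub_comm]
  apply Real.sqrt_le_iff.2 ⟨by linarith, ?_⟩
  linarith [mul_nonneg he.le hP]

/-- Positivity and monotonicity of the smaller eigenvalue. -/
theorem saprek_smaller_eigenvalue_pos_mono (μ ε : ℝ) (hμ : 1 ≤ μ) (hε : 0 < ε)
    (lam : ℝ → ℝ)
    (hlam : ∀ σ : ℝ, lam σ =
      ((μ - 2 + 2 / ε) * σ ^ 2 + 1) / (2 * (μ + 1 / ε))
        - (1 / (μ + 1 / ε)) *
            Real.sqrt (((μ - 2 + 2 / ε) * σ ^ 2 + 1) ^ 2 / 4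
              - (1 / ε) * σ ^ 4 * ((μ + 1 / ε) - σ ^ 2))) :
    (∀ σ : ℝ, 0 < σ → σ ≤ 1 → 0 < lam σ) ∧
    (∀ σ₁ σ₂ : ℝ, 0 < σ₁ → σ₁ ≤ σ₂ → σ₂ ≤ 1 → lam σ₁ ≤ lam σ₂) := by
  have he : 0 < 1 / ε := by positivity
  have hm : 0 < μ + 1 / ε := by linarith
  have hlam' : ∀ σ : ℝ, lam σ = (((μ - 2 + 2 * (1 / ε)) * σ ^ 2 + 1) / 2
      - √(((μ - 2 + 2 * (1 / ε)) * σ ^ 2 + 1) ^ 2 / 4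
        - (1 / ε) * (σ ^ 2) ^ 2 * ((μ + 1 / ε) - σ ^ 2))) / (μ + 1 / ε) := by
    intro σ
    rw [hlam, ← pow_mul, mul_one_div, ← div_div, sub_div, one_div_mul_eq_div]
  constructor
  · intro σ h0 h1
    rw [hlam']
    exact div_pos (block_smaller_root_pos hμ he (by positivity) (pow_le_one₀ h0.le h1)) hm
  · intro σ₁ σ₂ h0 h12 h2
    rw [hlam', hlam']
    exact div_le_div_of_nonneg_right (block_smaller_root_mono hμ he (by positivity)
      (pow_le_pow_left₀ h0.le h12 2) (pow_le_one₀ (h0.le.trans h12) h2)) hm.le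
end

section
/- Convergence of SAP-REK(ε) (Theorem 5): Let A ∈ ℝ^{m×n} have every row and every column nonzero, with ‖A‖_F = 1, let b ∈ ℝ^m and ε > 0. Let z* be the orthogonal projection of b onto the orthogonal complement of the column space of A, and let x* be the vector in the row space of A with A x* = b − z*. Set σ = σ_min(A) (the smallest nonzero singular value of A) and λ = min( 1/(m + 1/ε), ((m − 2 + 2/ε)σ² + 1)/(2(m + 1/ε)) − (1/(m + 1/ε)) √( (((m − 2 + 2/ε)σ² + 1)²)/4 − (1/ε)σ⁴((m + 1/ε) − σ²) ) ). Fix z^0 = b and x^0 in the row space of A. For each pair of index sequences ((i_1,…,i_k),(j_1,…,j_k)) ∈ {1,…,m}^k × {1,…,n}^k define iterates (z^t; x^t) = (z^{t−1}; x^{t−1}) − (1/d_t) K_t (A_{:j_t}ᵀ z^{t−1} ; z^{t−1}_{i_t} + A_{i_t:} x^{t−1} − b_{i_t}), where d_t = ‖A_{:j_t}‖²(1 + (1/ε)‖A_{i_t:}‖²) − A_{i_t j_t}² and K_t has blocks K₁₁ = (1 + (1/ε)‖A_{i_t:}‖²) A_{:j_t} − A_{i_t j_t} I_{:i_t}, K₁₂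 = −A_{i_t j_t} A_{:j_t} + ‖A_{:j_t}‖² I_{:i_t}, K₂₁ = −(1/ε) A_{i_t j_t} A_{i_t:}ᵀ, K₂₂ = (1/ε) ‖A_{:j_t}‖² A_{i_t:}ᵀ. Then the expectation, i.e. the sum over all such pairs of sequences weighted by ∏_{t=1}^k p_{i_t} q_{j_t} with p_i = (1 + (1/ε)‖A_{i:}‖²)/(m + (1/ε)) and q_j = ‖A_{:j}‖², of ‖z^k − z*‖² + ε‖x^k − x*‖² is at most (1 − λ)^k (‖z^0 − z*‖² + ε‖x^0 − x*‖²). -/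
open Matrix BigOperators

/-- One step of SAP-REK(ε) in closed form, acting on the pair `(z, x)` with the sampled
row index `i = ij.1` and column index `j = ij.2`. -/
noncomputable def saprekStep {m n : ℕ} (A : Matrix (Fin m) (Fin n) ℝ) (b : Fin m → ℝ)
    (ε : ℝ) (p : (Fin m → ℝ) × (Fin n → ℝ)) (ij : Fin m × Fin n) :
    (Fin m → ℝ) × (Fin n → ℝ) :=
  let i := ij.1
  let j := ij.2
  let ci : ℝ := ∑ l, A i l ^ 2
  let cj : ℝ := ∑ l, A l j ^ 2
  let d : ℝ := cj * (1 + (1 / ε) * ci) - A i j ^ 2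
  let w1 : ℝ := ∑ l, A l j * p.1 l
  let w2 : ℝ := p.1 i + (∑ l, A i l * p.2 l) - b i
  (fun l => p.1 l - (1 / d) *
      (((1 + (1 / ε) * ci) * A l j - A i j * (if l = i then (1:ℝ) else 0)) * w1
        + (-(A i j) * A l j + cj * (if l = i then (1:ℝ) else 0)) * w2),
   fun l => p.2 l - (1 / d) *
      ((-(1 / ε) * A i j * A i l) * w1 + ((1 / ε) * cj * A i l) * w2))

/-- A one-step contraction in expectation, valid on an invariant set, iterates to `k` i.i.d.
steps. -/
lemma sum_prod_foldl_le {S α : Type*} [Fintype α] (step : S → α → S) (w : α → ℝ)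
    (hw : ∀ a, 0 ≤ w a) (V : S → ℝ) (P : S → Prop) (hP : ∀ s a, P s → P (step s a))
    (r : ℝ) (hr : 0 ≤ r) (h : ∀ s, P s → ∑ a, w a * V (step s a) ≤ r * V s) (k : ℕ) :
    ∀ s, P s → ∑ ω : Fin k → α, (∏ t, w (ω t)) * V ((List.ofFn ω).foldl step s)
      ≤ r ^ k * V s := by
  induction k with
  | zero => intro s _; simp
  | succ k ih =>
    intro s hs
    rw [← Equiv.sum_comp (Fin.consEquiv (fun _ => α)), Fintype.sum_prod_type]
    have key : ∀ a, ∑ ω : Fin k → α, (∏ t, w ((Fin.consEquiv (fun _ => α)) (a, ω) t)) *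
        V ((List.ofFn ((Fin.consEquiv (fun _ => α)) (a, ω))).foldl step s)
        ≤ r ^ k * (w a * V (step s a)) := by
      intro a
      have := mul_le_mul_of_nonneg_left (ih (step s a) (hP s a hs)) (hw a)
      rw [Finset.mul_sum] at this
      calc _ = _ := Finset.sum_congr rfl fun ω _ => by
            simp only [Fin.consEquiv_apply, Fin.prod_univ_succ, Fin.cons_zero, Fin.cons_succ,
              List.ofFn_succ, List.foldl_cons]
            exact mul_assoc _ _ _
        _ ≤ _ := this
        _ = _ := by ring
    calc _ ≤ ∑ a, r ^ k * (w a * V (step s a)) := Finset.sum_le_sum fun a _ => key a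
      _ = r ^ k * ∑ a, w a * V (step s a) := by rw [Finset.mul_sum]
      _ ≤ r ^ k * (r * V s) := mul_le_mul_of_nonneg_left (h s hs) (pow_nonneg hr k)
      _ = _ := by ring

/-- Bounds on the smaller root of the characteristic polynomial, truncated at `1`. -/
lemma min_one_root_bounds {M δ t : ℝ} (hM : 1 ≤ M) (hδ : 0 < δ) (ht : 0 < t) (ht1 : t ≤ 1)
    {ν : ℝ} (hν : ν = min 1 (((M - 2 + 2 * δ) * t + 1) / 2
      - √(((M - 2 + 2 * δ) * t + 1) ^ 2 / 4 - δ * t ^ 2 * (M + δ - t)))) :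
    0 ≤ ν ∧ ν ≤ 1 ∧ ν ≤ δ * t ∧
      0 ≤ ν ^ 2 - ((M - 2 + 2 * δ) * t + 1) * ν + δ * t ^ 2 * (M + δ - t) := by
  set T := (M - 2 + 2 * δ) * t + 1 with hT
  set D := δ * t ^ 2 * (M + δ - t) with hD
  have hdisc : T ^ 2 / 4 - D
      = (((M + δ - 2) * t + 1 - δ * t) / 2) ^ 2 + δ * t * (1 - t) ^ 2 := by
    rw [hT, hD]; ring
  have hx : 0 ≤ δ * t * (1 - t) ^ 2 := by positivity
  have hD0 : 0 ≤ D := by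
    have : 0 ≤ M + δ - t := by linarith
    positivity
  have hT0 : 0 ≤ T := by
    have : 0 ≤ (M - 1) * t := mul_nonneg (by linarith) ht.le
    have : 0 ≤ δ * t := by positivity
    rw [hT]; nlinarith
  set R := √(T ^ 2 / 4 - D) with hR
  have hR0 : 0 ≤ R := Real.sqrt_nonneg _
  have hR2 : R ^ 2 = T ^ 2 / 4 - D := Real.sq_sqrt (by rw [hdisc]; positivity)
  have h1 : R ≤ T / 2 := abs_le_of_sq_le_sq' (by nlinarith) (by linarith) |>.2
  have h2 : ((M + δ - 2) * t + 1 - δ * t) / 2 ≤ R :=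
    abs_le_of_sq_le_sq' (by rw [hR2, hdisc]; linarith) hR0 |>.2
  have hνμ : ν ≤ T / 2 - R := hν ▸ min_le_right _ _
  refine ⟨?_, hν ▸ min_le_left _ _, ?_, ?_⟩
  · rw [hν]; exact le_min zero_le_one (by linarith)
  · refine hνμ.trans ?_
    rw [hT]; linarith
  · have : 0 ≤ (T / 2 - R - ν) * (T / 2 + R - ν) := mul_nonneg (by linarith) (by linarith)
    nlinarith

/-- Nonnegativity of the characteristic polynomial propagates from `t` to all `y ∈ [t, 1]`: a cubic
with negative leading coefficient which is `≤ 0` at `0` and `≥ 0` at `t` and `1`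
is `≥ 0` on `[t, 1]`. -/
lemma charpoly_nonneg_of_le {M δ t y ν : ℝ} (hM : 1 ≤ M) (hδ : 0 < δ) (ht : 0 < t)
    (hty : t ≤ y) (hy : y ≤ 1) (hν0 : 0 ≤ ν) (hν1 : ν ≤ 1) (hνt : ν ≤ δ * t)
    (h : 0 ≤ ν ^ 2 - ((M - 2 + 2 * δ) * t + 1) * ν + δ * t ^ 2 * (M + δ - t)) :
    0 ≤ ν ^ 2 - ((M - 2 + 2 * δ) * y + 1) * ν + δ * y ^ 2 * (M + δ - y) := by
  rcases hty.eq_or_lt with rfl | hty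
  · exact h
  have hνδ : ν ≤ δ := hνt.trans (by nlinarith)
  have h1 : 0 ≤ (ν - δ) * (ν - (M + δ - 1)) :=
    mul_nonneg_of_nonpos_of_nonpos (by linarith) (by linarith)
  rcases hy.eq_or_lt with rfl | hy
  · nlinarith
  have h0 : 0 ≤ ν * (1 - ν) := mul_nonneg hν0 (by linarith)
  have e1 : 0 < y - t := by linarith
  have e2 : 0 < 1 - y := by linarith
  have e3 : 0 < 1 - t := by linarith
  have hy0 : 0 < y := by linarith
  have key : (t * (1 - t)) *
      (ν ^ 2 - ((M - 2 + 2 * δ) * y + 1) * ν + δ * y ^ 2 * (M + δ - y))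
      = ν * (1 - ν) * ((y - t) * (1 - y) * (1 - t))
        + (ν ^ 2 - ((M - 2 + 2 * δ) * t + 1) * ν + δ * t ^ 2 * (M + δ - t)) * (y * (1 - y))
        + (ν - δ) * (ν - (M + δ - 1)) * (y * t * (y - t))
        + δ * (t * y * (y - t) * (1 - y) * (1 - t)) := by
    ring
  refine nonneg_of_mul_nonneg_right (a := t * (1 - t)) ?_ (by positivity)
  rw [key]; positivity

/-- The quadratic form attached to one singular direction is nonnegative. -/
lemma singular_form_nonneg {M δ ε y ν : ℝ} (hM : 1 ≤ M) (hε : 0 < ε) (hδ : δ = 1 / ε)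
    (hy : 0 < y) (hy1 : y ≤ 1) (hνy : ν ≤ δ * y)
    (h : 0 ≤ ν ^ 2 - ((M - 2 + 2 * δ) * y + 1) * ν + δ * y ^ 2 * (M + δ - y)) (α β : ℝ) :
    0 ≤ (M + δ - 2) * α ^ 2 - 2 * y * α * β + 2 * α * β + y * β ^ 2
      + (1 - ν) * (α ^ 2 / y) - ν * ε * β ^ 2 := by
  have hδ0 : 0 < δ := by rw [hδ]; positivity
  have hεδ : ε * δ = 1 := by rw [hδ]; field_simp
  have hp : 0 ≤ (M + δ - 2) * y + 1 - ν := by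
    have : 0 ≤ (M - 1) * y := mul_nonneg (by linarith) hy.le
    nlinarith
  have hq : 0 ≤ δ * y - ν := by linarith
  have hdet : y * δ * (1 - y) ^ 2 ≤ ((M + δ - 2) * y + 1 - ν) * (δ * y - ν) := by
    nlinarith
  obtain ⟨a, rfl⟩ : ∃ a, α = y * a := ⟨α / y, by field_simp⟩
  have e : (M + δ - 2) * (y * a) ^ 2 - 2 * y * (y * a) * β + 2 * (y * a) * β + y * β ^ 2
      + (1 - ν) * ((y * a) ^ 2 / y) - ν * ε * β ^ 2
      = ((M + δ - 2) * y + 1 - ν) * y * a ^ 2 + 2 * (y * (1 - y)) * a * β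
        + (δ * y - ν) * ε * β ^ 2 := by
    have : (y * a) ^ 2 / y = y * a ^ 2 := by field_simp
    rw [this]
    linear_combination (-(y * β ^ 2)) * hεδ
  rw [e]
  set p := (M + δ - 2) * y + 1 - ν
  set q := δ * y - ν
  have hdet' : (y * (1 - y)) ^ 2 ≤ (p * y) * (q * ε) := by
    have := mul_le_mul_of_nonneg_left hdet (by positivity : 0 ≤ y * ε)
    calc (y * (1 - y)) ^ 2 = y * ε * (y * δ * (1 - y) ^ 2) := by
          linear_combination (-(y ^ 2 * (1 - y) ^ 2)) * hεδ
      _ ≤ _ := this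
      _ = _ := by ring
  have hP : 0 ≤ p * y := by positivity
  have hQ : 0 ≤ q * ε := by positivity
  set P := p * y
  set Q := q * ε
  set B := y * (1 - y)
  rcases hP.eq_or_lt with h0 | hpos
  · have hB : B = 0 := by
      rw [← h0, zero_mul] at hdet'
      exact pow_eq_zero_iff two_ne_zero |>.1 (le_antisymm hdet' (sq_nonneg _))
    rw [hB, ← h0]
    have : 0 ≤ Q * β ^ 2 := by positivity
    linarith
  · refine nonneg_of_mul_nonneg_right (a := P) ?_ hpos
    have : 0 ≤ (P * Q - B ^ 2) * β ^ 2 := mul_nonneg (by linarith) (sq_nonneg _)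
    nlinarith [sq_nonneg (P * a + B * β)]

/-- Spectral theorem for `Aᵀ * A` in coordinates. -/
lemma exists_eigenbasis_gram {m n : ℕ} (A : Matrix (Fin m) (Fin n) ℝ) :
    ∃ (y : Fin n → ℝ) (v : Fin n → Fin n → ℝ), (∀ k, v k ≠ 0) ∧
      (∀ k, (Aᵀ * A) *ᵥ v k = y k • v k) ∧
      ∀ f g : Fin n → ℝ, f ⬝ᵥ g = ∑ k, (v k ⬝ᵥ f) * (v k ⬝ᵥ g) := by
  have hH : (Aᵀ * A).IsHermitian := by
    simpa using Matrix.isHermitian_conjTranspose_mul_self A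
  refine ⟨hH.eigenvalues, fun k => (hH.eigenvectorBasis k).ofLp, fun k h => ?_,
    fun k => hH.mulVec_eigenvectorBasis k, fun f g => ?_⟩
  · exact hH.eigenvectorBasis.orthonormal.ne_zero k (by ext i; exact congrFun h i)
  · have := hH.eigenvectorBasis.sum_inner_mul_inner (WithLp.toLp 2 f) (WithLp.toLp 2 g)
    simp only [EuclideanSpace.inner_eq_star_dotProduct, star_trivial] at this
    rw [dotProduct_comm, ← this]
    exact Finset.sum_congr rfl fun k _ => by rw [dotProduct_comm g]

lemma mulVec_dotProduct_eq {m n : ℕ} (A : Matrix (Fin m) (Fin n) ℝ) (f : Fin n → ℝ)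
    (e : Fin m → ℝ) : (A *ᵥ f) ⬝ᵥ e = f ⬝ᵥ (Aᵀ *ᵥ e) := by
  rw [dotProduct_comm, dotProduct_mulVec, mulVec_transpose, dotProduct_comm]

lemma mulVec_dotProduct_mulVec {m n : ℕ} (A : Matrix (Fin m) (Fin n) ℝ) (f g : Fin n → ℝ) :
    (A *ᵥ f) ⬝ᵥ (A *ᵥ g) = f ⬝ᵥ ((Aᵀ * A) *ᵥ g) := by
  rw [mulVec_dotProduct_eq, mulVec_mulVec]

lemma dotProduct_self_real_nonneg {n : ℕ} (f : Fin n → ℝ) : 0 ≤ f ⬝ᵥ f :=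
  Finset.sum_nonneg fun i _ => mul_self_nonneg (f i)

lemma mulVec_dotProduct_self_le {m n : ℕ} (A : Matrix (Fin m) (Fin n) ℝ)
    (hF : (∑ i, ∑ l, A i l ^ 2) = 1) (f : Fin n → ℝ) :
    (A *ᵥ f) ⬝ᵥ (A *ᵥ f) ≤ f ⬝ᵥ f := by
  calc (A *ᵥ f) ⬝ᵥ (A *ᵥ f) = ∑ i, (∑ l, A i l * f l) ^ 2 := by
        simp [dotProduct, mulVec, pow_two]
    _ ≤ ∑ i, (∑ l, A i l ^ 2) * ∑ l, f l ^ 2 :=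
        Finset.sum_le_sum fun i _ => Finset.sum_mul_sq_le_sq_mul_sq _ _ _
    _ = f ⬝ᵥ f := by rw [← Finset.sum_mul, hF, one_mul]; simp [dotProduct, pow_two]

/-- Eigenvalues of `Aᵀ * A` lie in `[0, 1]` when `‖A‖_F = 1`. -/
lemma gram_eigenvalue_mem {m n : ℕ} (A : Matrix (Fin m) (Fin n) ℝ)
    (hF : (∑ i, ∑ l, A i l ^ 2) = 1) {y : ℝ} {v : Fin n → ℝ} (hv : v ≠ 0)
    (h : (Aᵀ * A) *ᵥ v = y • v) : 0 ≤ y ∧ y ≤ 1 := by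
  have hpos : 0 < v ⬝ᵥ v :=
    lt_of_le_of_ne (dotProduct_self_real_nonneg v) fun h0 => hv (dotProduct_self_eq_zero.1 h0.symm)
  have e : (A *ᵥ v) ⬝ᵥ (A *ᵥ v) = y * (v ⬝ᵥ v) := by
    rw [mulVec_dotProduct_mulVec, h, dotProduct_smul, smul_eq_mul]
  have h1 := mulVec_dotProduct_self_le A hF v
  have h0 := dotProduct_self_real_nonneg (A *ᵥ v)
  rw [e] at h0 h1
  exact ⟨nonneg_of_mul_nonneg_left h0 hpos, by
    by_contra hc
    push Not at hc
    nlinarith⟩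

/-- Coercivity of the averaged one-step decrease. -/
lemma decrease_form_coercive {m n : ℕ} (A : Matrix (Fin m) (Fin n) ℝ)
    (hF : (∑ i, ∑ l, A i l ^ 2) = 1) {M δ ε t ν : ℝ} (hM : 1 ≤ M) (hε : 0 < ε) (hδ : δ = 1 / ε)
    (ht : 0 < t)
    (hmin : ∀ (s : ℝ) (v : Fin n → ℝ), s ≠ 0 → v ≠ 0 → (Aᵀ * A) *ᵥ v = s • v → t ≤ s)
    (hν0 : 0 ≤ ν) (hν1 : ν ≤ 1) (hνt : ν ≤ δ * t)
    (h : 0 ≤ ν ^ 2 - ((M - 2 + 2 * δ) * t + 1) * ν + δ * t ^ 2 * (M + δ - t))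
    (e : Fin m → ℝ) (f : Fin n → ℝ) (hf : ∀ v, A *ᵥ v = 0 → v ⬝ᵥ f = 0) :
    ν * (e ⬝ᵥ e + ε * (f ⬝ᵥ f)) ≤
      (M + δ) * ((Aᵀ *ᵥ e) ⬝ᵥ (Aᵀ *ᵥ e)) - 2 * ((Aᵀ *ᵥ e) ⬝ᵥ (Aᵀ *ᵥ (e + A *ᵥ f)))
        + (e + A *ᵥ f) ⬝ᵥ (e + A *ᵥ f) := by
  obtain ⟨y, v, hv, hev, hpars⟩ := exists_eigenbasis_gram A
  have hδ0 : 0 < δ := by rw [hδ]; positivity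
  have hmem k := gram_eigenvalue_mem A hF (hv k) (hev k)
  have hHv : ∀ k g, v k ⬝ᵥ ((Aᵀ * A) *ᵥ g) = y k * (v k ⬝ᵥ g) := by
    intro k g
    rw [← mulVec_dotProduct_mulVec, dotProduct_comm, mulVec_dotProduct_mulVec, hev,
      dotProduct_smul, smul_eq_mul, dotProduct_comm]
  set a : Fin n → ℝ := Aᵀ *ᵥ e with ha
  have hker : ∀ k, y k = 0 → v k ⬝ᵥ a = 0 ∧ v k ⬝ᵥ f = 0 := by
    intro k hk
    have hA : A *ᵥ v k = 0 := by
      rw [← dotProduct_self_eq_zero, mulVec_dotProduct_mulVec, hev, hk, zero_smul,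
        dotProduct_zero]
    refine ⟨?_, hf _ hA⟩
    rw [ha, ← mulVec_dotProduct_eq, hA, zero_dotProduct]
  -- the part of `e` in the column space has squared norm `∑ αₖ² / yₖ`
  have hbessel : ∑ k, (v k ⬝ᵥ a) ^ 2 / y k ≤ e ⬝ᵥ e := by
    set g : Fin n → ℝ := ∑ k, ((v k ⬝ᵥ a) / y k) • v k with hg
    have h1 : ∀ u : Fin n → ℝ, g ⬝ᵥ u = ∑ k, (v k ⬝ᵥ a) / y k * (v k ⬝ᵥ u) := by
      intro u
      simp [hg, sum_dotProduct]
    have h2 : (A *ᵥ g) ⬝ᵥ e = ∑ k, (v k ⬝ᵥ a) ^ 2 / y k := by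
      rw [mulVec_dotProduct_eq, h1]
      exact Finset.sum_congr rfl fun k _ => by ring
    have h3 : (A *ᵥ g) ⬝ᵥ (A *ᵥ g) = ∑ k, (v k ⬝ᵥ a) ^ 2 / y k := by
      rw [mulVec_dotProduct_mulVec, h1, ← h2, mulVec_dotProduct_eq, ← ha, dotProduct_comm g, hpars]
      refine Finset.sum_congr rfl fun k _ => ?_
      rcases eq_or_ne (y k) 0 with h0 | h0
      · rw [(hker k h0).1]; simp
      · rw [hHv]; field_simp
    have h4 := dotProduct_self_real_nonneg (e - A *ᵥ g)
    rw [sub_dotProduct, dotProduct_sub, dotProduct_sub, dotProduct_comm e (A *ᵥ g), h2, h3] at h4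
    linarith
  have e1 : a ⬝ᵥ (Aᵀ *ᵥ (e + A *ᵥ f)) = a ⬝ᵥ a + a ⬝ᵥ ((Aᵀ * A) *ᵥ f) := by
    rw [mulVec_add, mulVec_mulVec, dotProduct_add]
  have e2 : (e + A *ᵥ f) ⬝ᵥ (e + A *ᵥ f)
      = e ⬝ᵥ e + 2 * (a ⬝ᵥ f) + f ⬝ᵥ ((Aᵀ * A) *ᵥ f) := by
    rw [add_dotProduct, dotProduct_add, dotProduct_add, dotProduct_comm e (A *ᵥ f),
      mulVec_dotProduct_eq, mulVec_dotProduct_mulVec, dotProduct_comm f (Aᵀ *ᵥ e)]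
    ring
  have hsum : 0 ≤ ∑ k, ((M + δ - 2) * (v k ⬝ᵥ a) ^ 2 - 2 * y k * (v k ⬝ᵥ a) * (v k ⬝ᵥ f)
      + 2 * (v k ⬝ᵥ a) * (v k ⬝ᵥ f) + y k * (v k ⬝ᵥ f) ^ 2
      + (1 - ν) * ((v k ⬝ᵥ a) ^ 2 / y k) - ν * ε * (v k ⬝ᵥ f) ^ 2) := by
    refine Finset.sum_nonneg fun k _ => ?_
    rcases eq_or_ne (y k) 0 with h0 | h0
    · rw [(hker k h0).1, (hker k h0).2]; simp
    · have hty := hmin _ _ h0 (hv k) (hev k)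
      exact singular_form_nonneg hM hε hδ (ht.trans_le hty) (hmem k).2
        (hνt.trans (mul_le_mul_of_nonneg_left hty hδ0.le))
        (charpoly_nonneg_of_le hM hδ0 ht hty (hmem k).2 hν0 hν1 hνt h) _ _
  have s1 : a ⬝ᵥ a = ∑ k, (v k ⬝ᵥ a) ^ 2 := by
    rw [hpars]; exact Finset.sum_congr rfl fun k _ => by ring
  have s2 : a ⬝ᵥ f = ∑ k, (v k ⬝ᵥ a) * (v k ⬝ᵥ f) := hpars _ _
  have s3 : f ⬝ᵥ f = ∑ k, (v k ⬝ᵥ f) ^ 2 := by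
    rw [hpars]; exact Finset.sum_congr rfl fun k _ => by ring
  have s4 : a ⬝ᵥ ((Aᵀ * A) *ᵥ f) = ∑ k, y k * (v k ⬝ᵥ a) * (v k ⬝ᵥ f) := by
    rw [hpars]; exact Finset.sum_congr rfl fun k _ => by rw [hHv]; ring
  have s5 : f ⬝ᵥ ((Aᵀ * A) *ᵥ f) = ∑ k, y k * (v k ⬝ᵥ f) ^ 2 := by
    rw [hpars]; exact Finset.sum_congr rfl fun k _ => by rw [hHv]; ring
  have hrew : ∑ k, ((M + δ - 2) * (v k ⬝ᵥ a) ^ 2 - 2 * y k * (v k ⬝ᵥ a) * (v k ⬝ᵥ f)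
      + 2 * (v k ⬝ᵥ a) * (v k ⬝ᵥ f) + y k * (v k ⬝ᵥ f) ^ 2
      + (1 - ν) * ((v k ⬝ᵥ a) ^ 2 / y k) - ν * ε * (v k ⬝ᵥ f) ^ 2)
      = (M + δ - 2) * (a ⬝ᵥ a) - 2 * (a ⬝ᵥ ((Aᵀ * A) *ᵥ f)) + 2 * (a ⬝ᵥ f)
        + f ⬝ᵥ ((Aᵀ * A) *ᵥ f) + (1 - ν) * (∑ k, (v k ⬝ᵥ a) ^ 2 / y k)
        - ν * ε * (f ⬝ᵥ f) := by
    rw [s1, s2, s3, s4, s5]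
    simp only [Finset.mul_sum, ← Finset.sum_add_distrib, ← Finset.sum_sub_distrib]
    exact Finset.sum_congr rfl fun k _ => by ring
  rw [hrew] at hsum
  rw [e1, e2]
  have := mul_le_mul_of_nonneg_left hbessel (by linarith : 0 ≤ 1 - ν)
  linarith

/-- Pythagorean identity for one step: the weighted squared error drops by `wᵀ G⁻¹ w`, where `w` is
the sketched residual and `G` the sketched `2 × 2` Gram matrix. -/
lemma saprekStep_energy {m n : ℕ} (A : Matrix (Fin m) (Fin n) ℝ) (b : Fin m → ℝ) {ε : ℝ}
    (hε : 0 < ε) (zs : Fin m → ℝ) (hzs : Aᵀ *ᵥ zs = 0) (xs : Fin n → ℝ)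
    (hxs : A *ᵥ xs = b - zs) (p : (Fin m → ℝ) × (Fin n → ℝ)) (i : Fin m) (j : Fin n)
    (hd : (∑ l, A l j ^ 2) * (1 + (1 / ε) * ∑ l, A i l ^ 2) - A i j ^ 2 ≠ 0) :
    (∑ l, ((saprekStep A b ε p (i, j)).1 - zs) l ^ 2)
        + ε * ∑ l, ((saprekStep A b ε p (i, j)).2 - xs) l ^ 2
      = (∑ l, (p.1 - zs) l ^ 2) + ε * (∑ l, (p.2 - xs) l ^ 2)
        - (1 / ((∑ l, A l j ^ 2) * (1 + (1 / ε) * ∑ l, A i l ^ 2) - A i j ^ 2)) *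
          ((1 + (1 / ε) * ∑ l, A i l ^ 2) * (Aᵀ *ᵥ (p.1 - zs)) j ^ 2
            - 2 * A i j * (Aᵀ *ᵥ (p.1 - zs)) j * ((p.1 - zs) + A *ᵥ (p.2 - xs)) i
            + (∑ l, A l j ^ 2) * ((p.1 - zs) + A *ᵥ (p.2 - xs)) i ^ 2) := by
  obtain ⟨z, x⟩ := p
  set e := z - zs with he
  set f := x - xs with hf
  set ci := ∑ l, A i l ^ 2 with hci
  set cj := ∑ l, A l j ^ 2 with hcj
  set d := cj * (1 + (1 / ε) * ci) - A i j ^ 2 with hdd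
  have hw1 : ∑ l, A l j * z l = (Aᵀ *ᵥ e) j := by
    rw [he, mulVec_sub, hzs, sub_zero]; rfl
  have hw2 : z i + (∑ l, A i l * x l) - b i = (e + A *ᵥ f) i := by
    rw [he, hf, mulVec_sub, hxs]
    simp only [Pi.add_apply, Pi.sub_apply, mulVec, dotProduct]
    ring
  set w1 := (Aᵀ *ᵥ e) j with hw1'
  set w2 := (e + A *ᵥ f) i with hw2'
  set r := (1 + (1 / ε) * ci) * w1 - A i j * w2 with hr
  set s := -(A i j) * w1 + cj * w2 with hs
  have h1 : ∀ l, ((saprekStep A b ε (z, x) (i, j)).1 - zs) l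
      = e l - (1 / d) * (r * A l j + s * (if l = i then (1:ℝ) else 0)) := by
    intro l
    simp only [saprekStep, Pi.sub_apply]
    rw [hw1, hw2, ← hci, ← hcj, ← hdd, hr, hs, he, Pi.sub_apply]
    ring
  have h2 : ∀ l, ((saprekStep A b ε (z, x) (i, j)).2 - xs) l
      = f l - (1 / d) * (1 / ε) * s * A i l := by
    intro l
    simp only [saprekStep, Pi.sub_apply]
    rw [hw1, hw2, ← hci, ← hcj, ← hdd, hs, hf, Pi.sub_apply]
    ring
  simp only [h1, h2]
  have g1 : ∑ l, (e l - (1 / d) * (r * A l j + s * (if l = i then (1:ℝ) else 0))) ^ 2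
      = (∑ l, e l ^ 2) - 2 / d * (r * w1 + s * e i)
        + (1 / d) ^ 2 * (r ^ 2 * cj + 2 * r * s * A i j + s ^ 2) := by
    have k1 : w1 = ∑ l, A l j * e l := rfl
    have k2 : e i = ∑ l, (if l = i then (1:ℝ) else 0) * e l := by simp
    have k3 : A i j = ∑ l, (if l = i then (1:ℝ) else 0) * A l j := by simp
    have k4 : (1:ℝ) = ∑ l : Fin m, (if l = i then (1:ℝ) else 0) := by simp
    have k5 : ∀ l, (if l = i then (1:ℝ) else 0) ^ 2 = (if l = i then (1:ℝ) else 0) := by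
      intro l; split_ifs <;> simp
    have : ∀ l, (e l - (1 / d) * (r * A l j + s * (if l = i then (1:ℝ) else 0))) ^ 2
        = e l ^ 2 - 2 / d * r * (A l j * e l)
          - 2 / d * s * ((if l = i then (1:ℝ) else 0) * e l)
          + (1 / d) ^ 2 * r ^ 2 * A l j ^ 2
          + (1 / d) ^ 2 * (2 * r * s) * ((if l = i then (1:ℝ) else 0) * A l j)
          + (1 / d) ^ 2 * s ^ 2 * (if l = i then (1:ℝ) else 0) := by
      intro l
      linear_combination ((1 / d) ^ 2 * s ^ 2) * k5 l
    simp only [this, Finset.sum_add_distrib, Finset.sum_sub_distrib, ← Finset.mul_sum]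
    rw [← k1, ← k2, ← k3, ← k4, ← hcj]
    ring
  have g2 : ∑ l, (f l - (1 / d) * (1 / ε) * s * A i l) ^ 2
      = (∑ l, f l ^ 2) - 2 / d * (1 / ε) * s * (A *ᵥ f) i
        + ((1 / d) * (1 / ε) * s) ^ 2 * ci := by
    have k1 : (A *ᵥ f) i = ∑ l, A i l * f l := rfl
    have : ∀ l, (f l - (1 / d) * (1 / ε) * s * A i l) ^ 2
        = f l ^ 2 - 2 / d * (1 / ε) * s * (A i l * f l)
          + ((1 / d) * (1 / ε) * s) ^ 2 * A i l ^ 2 := by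
      intro l; ring
    simp only [this, Finset.sum_add_distrib, Finset.sum_sub_distrib, ← Finset.mul_sum]
    rw [← k1, ← hci]
  have hAf : (A *ᵥ f) i = w2 - e i := by rw [hw2', Pi.add_apply]; ring
  have hq : cj * r ^ 2 + 2 * A i j * r * s + (1 + (1 / ε) * ci) * s ^ 2
      = d * (r * w1 + s * w2) := by
    rw [hr, hs, hdd]; ring
  have hrs : (1 + (1 / ε) * ci) * w1 ^ 2 - 2 * A i j * w1 * w2 + cj * w2 ^ 2
      = r * w1 + s * w2 := by
    rw [hr, hs]; ring
  have hε' : ε * (1 / ε) = 1 := by field_simp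
  have hd' : d * (1 / d) = 1 := by field_simp
  rw [g1, g2, hAf, hrs]
  linear_combination ((1 / d) ^ 2) * hq + ((1 / d) * (r * w1 + s * w2)) * hd'
    + ((-2 / d) * s * (w2 - e i) + (1 / d) ^ 2 * s ^ 2 * (1 / ε) * ci) * hε'

/-- The averaged energy decreases at least by the averaged quadratic form. -/
lemma saprekStep_expected_energy_le {m n : ℕ} (A : Matrix (Fin m) (Fin n) ℝ) (b : Fin m → ℝ)
    {ε : ℝ} (hε : 0 < ε) (hrows : ∀ i, A i ≠ 0) (hcols : ∀ j, (fun l => A l j) ≠ 0)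
    (hF : (∑ i, ∑ l, A i l ^ 2) = 1)
    (zs : Fin m → ℝ) (hzs : Aᵀ *ᵥ zs = 0) (xs : Fin n → ℝ)
    (hxs : A *ᵥ xs = b - zs) (p : (Fin m → ℝ) × (Fin n → ℝ)) :
    ∑ ij : Fin m × Fin n, ((1 + (1 / ε) * ∑ l, A ij.1 l ^ 2) / ((m : ℝ) + 1 / ε))
        * (∑ l, A l ij.2 ^ 2) * ((∑ l, ((saprekStep A b ε p ij).1 - zs) l ^ 2)
        + ε * ∑ l, ((saprekStep A b ε p ij).2 - xs) l ^ 2)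
      ≤ (∑ l, (p.1 - zs) l ^ 2) + ε * (∑ l, (p.2 - xs) l ^ 2)
        - (1 / ((m : ℝ) + 1 / ε)) *
        (((m : ℝ) + 1 / ε) * ((Aᵀ *ᵥ (p.1 - zs)) ⬝ᵥ (Aᵀ *ᵥ (p.1 - zs)))
          - 2 * ((Aᵀ *ᵥ (p.1 - zs)) ⬝ᵥ (Aᵀ *ᵥ ((p.1 - zs) + A *ᵥ (p.2 - xs))))
          + ((p.1 - zs) + A *ᵥ (p.2 - xs)) ⬝ᵥ ((p.1 - zs) + A *ᵥ (p.2 - xs))) := by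
  have hN : 0 < (m : ℝ) + 1 / ε := by positivity
  set N := (m : ℝ) + 1 / ε with hNdef
  set E := (∑ l, (p.1 - zs) l ^ 2) + ε * (∑ l, (p.2 - xs) l ^ 2) with hE
  set W1 := Aᵀ *ᵥ (p.1 - zs) with hW1
  set W2 := (p.1 - zs) + A *ᵥ (p.2 - xs) with hW2
  have hpos : ∀ {k : ℕ} (u : Fin k → ℝ), u ≠ 0 → 0 < ∑ l, u l ^ 2 := by
    intro k u hu
    refine lt_of_le_of_ne (Finset.sum_nonneg fun l _ => sq_nonneg _) fun h0 => hu ?_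
    funext l
    have := (Finset.sum_eq_zero_iff_of_nonneg (fun l _ => sq_nonneg (u l))).1 h0.symm l
      (Finset.mem_univ l)
    simpa using this
  have hF' : ∑ j, ∑ l, A l j ^ 2 = 1 := by rw [Finset.sum_comm]; exact hF
  have hterm : ∀ ij : Fin m × Fin n,
      ((1 + (1 / ε) * ∑ l, A ij.1 l ^ 2) / N)
        * (∑ l, A l ij.2 ^ 2) * ((∑ l, ((saprekStep A b ε p ij).1 - zs) l ^ 2)
        + ε * ∑ l, ((saprekStep A b ε p ij).2 - xs) l ^ 2)
      ≤ (1 / N) * ((1 + (1 / ε) * ∑ l, A ij.1 l ^ 2) * (∑ l, A l ij.2 ^ 2) * E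
        - ((1 + (1 / ε) * ∑ l, A ij.1 l ^ 2) * W1 ij.2 ^ 2
          - 2 * (A ij.1 ij.2 * W1 ij.2 * W2 ij.1) + (∑ l, A l ij.2 ^ 2) * W2 ij.1 ^ 2)) := by
    rintro ⟨i, j⟩
    have hci : 0 < ∑ l, A i l ^ 2 := hpos _ (hrows i)
    have hcj : 0 < ∑ l, A l j ^ 2 := hpos _ (hcols j)
    have ha : A i j ^ 2 ≤ ∑ l, A l j ^ 2 :=
      Finset.single_le_sum (f := fun l => A l j ^ 2) (fun l _ => sq_nonneg _) (Finset.mem_univ i)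
    have hx : 0 < (∑ l, A l j ^ 2) * ((1 / ε) * ∑ l, A i l ^ 2) := by positivity
    have hd : 0 < (∑ l, A l j ^ 2) * (1 + (1 / ε) * ∑ l, A i l ^ 2) - A i j ^ 2 := by
      linarith
    simp only
    rw [saprekStep_energy A b hε zs hzs xs hxs p i j hd.ne', ← hE, ← hW1, ← hW2]
    have hC : 0 < 1 + (1 / ε) * ∑ l, A i l ^ 2 := by positivity
    generalize W1 j = w1
    generalize W2 i = w2
    generalize A i j = a at *
    generalize 1 + (1 / ε) * ∑ l, A i l ^ 2 = C at *
    generalize (∑ l, A l j ^ 2) = c at *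
    have hquad : 0 ≤ C * w1 ^ 2 - 2 * a * w1 * w2 + c * w2 ^ 2 := by
      refine nonneg_of_mul_nonneg_right (a := C) ?_ hC
      have : 0 ≤ (c * C - a ^ 2) * w2 ^ 2 := by positivity
      nlinarith [sq_nonneg (C * w1 - a * w2)]
    have hratio : 1 ≤ C * c * (1 / (c * C - a ^ 2)) := by
      rw [mul_one_div, le_div_iff₀ hd]
      nlinarith [sq_nonneg a]
    have h1 := mul_le_mul_of_nonneg_right hratio hquad
    rw [div_mul_eq_mul_div, div_mul_eq_mul_div, div_eq_mul_one_div, mul_comm _ (1 / N)]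
    refine mul_le_mul_of_nonneg_left ?_ (by positivity)
    linarith
  refine (Finset.sum_le_sum fun ij _ => hterm ij).trans (le_of_eq ?_)
  have hC : ∑ i, (1 + (1 / ε) * ∑ l, A i l ^ 2) = N := by
    rw [Finset.sum_add_distrib, ← Finset.mul_sum, hF]
    simp [hNdef]
  have t1 : ∑ ij : Fin m × Fin n,
      (1 + (1 / ε) * ∑ l, A ij.1 l ^ 2) * (∑ l, A l ij.2 ^ 2) = N := by
    rw [Fintype.sum_prod_type]
    simp only [← Finset.mul_sum, hF', mul_one]
    exact hC
  have t2 : ∑ ij : Fin m × Fin n, (1 + (1 / ε) * ∑ l, A ij.1 l ^ 2) * W1 ij.2 ^ 2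
      = N * (W1 ⬝ᵥ W1) := by
    rw [Fintype.sum_prod_type]
    simp only [← Finset.mul_sum, ← Finset.sum_mul, hC]
    simp only [dotProduct, pow_two]
  have t3 : ∑ ij : Fin m × Fin n, A ij.1 ij.2 * W1 ij.2 * W2 ij.1
      = W1 ⬝ᵥ (Aᵀ *ᵥ W2) := by
    rw [Fintype.sum_prod_type, Finset.sum_comm]
    simp only [dotProduct, mulVec, transpose_apply, Finset.mul_sum]
    exact Finset.sum_congr rfl fun j _ => Finset.sum_congr rfl fun i _ => by ring
  have t4 : ∑ ij : Fin m × Fin n, (∑ l, A l ij.2 ^ 2) * W2 ij.1 ^ 2 = W2 ⬝ᵥ W2 := by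
    rw [Fintype.sum_prod_type]
    simp only [← Finset.sum_mul, hF', one_mul]
    simp only [dotProduct, pow_two]
  rw [← Finset.mul_sum, Finset.sum_sub_distrib, Finset.sum_add_distrib, Finset.sum_sub_distrib,
    ← Finset.sum_mul, t1, t2, t4, ← Finset.mul_sum, t3]
  have hN' : 1 / N * N = 1 := by field_simp
  linear_combination E * hN'

/-- Convergence of SAP-REK(ε) (Theorem 5). -/
theorem saprek_convergence {m n : ℕ} (k : ℕ)
    (A : Matrix (Fin m) (Fin n) ℝ) (b : Fin m → ℝ) (ε : ℝ) (hε : 0 < ε)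
    (hrows : ∀ i, A i ≠ 0)
    (hcols : ∀ j, (fun l => A l j) ≠ 0)
    (hF : (∑ i, ∑ l, A i l ^ 2) = 1)
    (zs : Fin m → ℝ)
    (hzs_perp : ∀ w ∈ Submodule.span ℝ (Set.range fun j : Fin n => fun l => A l j),
      zs ⬝ᵥ w = 0)
    (hzs_proj : b - zs ∈ Submodule.span ℝ (Set.range fun j : Fin n => fun l => A l j))
    (xs : Fin n → ℝ)
    (hxs_row : xs ∈ Submodule.span ℝ (Set.range fun i : Fin m => A i))
    (hxs : A.mulVec xs = b - zs)
    (σ : ℝ) (hσ : 0 < σ)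
    (hσmin : IsLeast {t : ℝ | t ≠ 0 ∧ ∃ v : Fin n → ℝ, v ≠ 0 ∧
      (Aᵀ * A).mulVec v = t • v} (σ ^ 2))
    (lam : ℝ)
    (hlam : lam = min (1 / ((m : ℝ) + 1 / ε))
      ((((m : ℝ) - 2 + 2 / ε) * σ ^ 2 + 1) / (2 * ((m : ℝ) + 1 / ε))
        - (1 / ((m : ℝ) + 1 / ε)) *
            Real.sqrt ((((m : ℝ) - 2 + 2 / ε) * σ ^ 2 + 1) ^ 2 / 4
              - (1 / ε) * σ ^ 4 * (((m : ℝ) + 1 / ε) - σ ^ 2))))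
    (x0 : Fin n → ℝ)
    (hx0 : x0 ∈ Submodule.span ℝ (Set.range fun i : Fin m => A i)) :
    ∑ ω : Fin k → Fin m × Fin n,
        (∏ t, ((1 + (1 / ε) * ∑ l, A (ω t).1 l ^ 2) / ((m : ℝ) + 1 / ε))
              * (∑ l, A l (ω t).2 ^ 2)) *
          ((∑ l, (((List.ofFn ω).foldl (saprekStep A b ε) (b, x0)).1 - zs) l ^ 2)
            + ε * ∑ l, (((List.ofFn ω).foldl (saprekStep A b ε) (b, x0)).2 - xs) l ^ 2)
      ≤ (1 - lam) ^ k *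
          ((∑ l, (b - zs) l ^ 2) + ε * ∑ l, (x0 - xs) l ^ 2) := by
  have hδ : 0 < 1 / ε := by positivity
  have hM : (1 : ℝ) ≤ m := by
    have : m ≠ 0 := by rintro rfl; simp at hF
    exact_mod_cast Nat.one_le_iff_ne_zero.2 this
  have hN : 0 < (m : ℝ) + 1 / ε := by positivity
  have hker : ∀ g ∈ Submodule.span ℝ (Set.range fun i : Fin m => A i),
      ∀ v, A *ᵥ v = 0 → v ⬝ᵥ g = 0 := by
    intro g hg v hv
    induction hg using Submodule.span_induction with
    | mem g hg =>
      obtain ⟨i, rfl⟩ := hg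
      rw [dotProduct_comm]
      exact congrFun hv i
    | zero => exact dotProduct_zero v
    | add g h _ _ hg hh => rw [dotProduct_add, hg, hh, add_zero]
    | smul c g _ hg => rw [dotProduct_smul, hg, smul_zero]
  have hzs : Aᵀ *ᵥ zs = 0 := by
    funext j
    have := hzs_perp _ (Submodule.subset_span ⟨j, rfl⟩)
    rw [dotProduct_comm] at this
    exact this
  obtain ⟨hσne, u, hu, hue⟩ := hσmin.1
  have hσ1 : σ ^ 2 ≤ 1 := (gram_eigenvalue_mem A hF hu hue).2
  have hσ2 : 0 < σ ^ 2 := by positivity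
  have hmin : ∀ (s : ℝ) (v : Fin n → ℝ), s ≠ 0 → v ≠ 0 → (Aᵀ * A) *ᵥ v = s • v → σ ^ 2 ≤ s :=
    fun s v hs hv h => hσmin.2 ⟨hs, v, hv, h⟩
  have hν : ((m : ℝ) + 1 / ε) * lam = min 1 ((((m : ℝ) - 2 + 2 * (1 / ε)) * σ ^ 2 + 1) / 2
      - √((((m : ℝ) - 2 + 2 * (1 / ε)) * σ ^ 2 + 1) ^ 2 / 4
        - 1 / ε * (σ ^ 2) ^ 2 * ((m : ℝ) + 1 / ε - σ ^ 2))) := by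
    rw [hlam, mul_min_of_nonneg _ _ hN.le, mul_one_div_cancel hN.ne', ← pow_mul,
      ← div_eq_mul_one_div (2 : ℝ) ε]
    congr 1
    rw [mul_sub, ← mul_assoc, mul_one_div_cancel hN.ne', one_mul]
    congr 1
    field_simp
  obtain ⟨hν0, hν1, hνt, hchar⟩ := min_one_root_bounds hM hδ hσ2 hσ1 hν
  have hlam1 : 0 ≤ 1 - lam := by
    have : 0 ≤ ((m : ℝ) + 1 / ε) * (1 - lam) := by linarith
    exact nonneg_of_mul_nonneg_right this hN
  have hstep : ∀ p : (Fin m → ℝ) × (Fin n → ℝ),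
      (∀ v, A *ᵥ v = 0 → v ⬝ᵥ (p.2 - xs) = 0) →
      ∑ ij : Fin m × Fin n, ((1 + (1 / ε) * ∑ l, A ij.1 l ^ 2) / ((m : ℝ) + 1 / ε))
        * (∑ l, A l ij.2 ^ 2) * ((∑ l, ((saprekStep A b ε p ij).1 - zs) l ^ 2)
        + ε * ∑ l, ((saprekStep A b ε p ij).2 - xs) l ^ 2)
      ≤ (1 - lam) * ((∑ l, (p.1 - zs) l ^ 2) + ε * ∑ l, (p.2 - xs) l ^ 2) := by
    intro p hp
    refine (saprekStep_expected_energy_le A b hε hrows hcols hF zs hzs xs hxs p).trans ?_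
    have h1 := mul_le_mul_of_nonneg_left (decrease_form_coercive A hF hM hε rfl hσ2 hmin hν0 hν1
      hνt hchar (p.1 - zs) (p.2 - xs) hp) (one_div_pos.2 hN).le
    rw [← mul_assoc, ← mul_assoc, one_div_mul_cancel hN.ne', one_mul] at h1
    have h2 : ∀ {k : ℕ} (g : Fin k → ℝ), g ⬝ᵥ g = ∑ l, g l ^ 2 := fun g => by
      simp only [dotProduct, pow_two]
    rw [h2 (p.1 - zs), h2 (p.2 - xs)] at h1
    linarith
  refine sum_prod_foldl_le (saprekStep A b ε)
    (fun ij => ((1 + (1 / ε) * ∑ l, A ij.1 l ^ 2) / ((m : ℝ) + 1 / ε)) * (∑ l, A l ij.2 ^ 2))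
    (fun ij => by positivity)
    (fun p => (∑ l, (p.1 - zs) l ^ 2) + ε * ∑ l, (p.2 - xs) l ^ 2)
    (fun p => ∀ v, A *ᵥ v = 0 → v ⬝ᵥ (p.2 - xs) = 0) ?_ (1 - lam) hlam1 hstep k (b, x0) ?_
  · rintro p ⟨i, j⟩ hp v hv
    obtain ⟨c, hc⟩ : ∃ c : ℝ, (saprekStep A b ε p (i, j)).2 - xs = (p.2 - xs) - c • A i := by
      simp only [saprekStep]
      generalize (∑ l, A l j * p.1 l) = w1
      generalize p.1 i + (∑ l, A i l * p.2 l) - b i = w2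
      generalize (∑ l, A l j ^ 2) = cj
      generalize cj * (1 + (1 / ε) * ∑ l, A i l ^ 2) - A i j ^ 2 = d
      refine ⟨1 / d * (-(1 / ε) * A i j * w1 + 1 / ε * cj * w2), funext fun l => ?_⟩
      simp only [Pi.sub_apply, Pi.smul_apply, smul_eq_mul]
      ring
    rw [hc, dotProduct_sub, hp v hv, dotProduct_smul,
      hker _ (Submodule.subset_span ⟨i, rfl⟩) v hv, smul_zero, sub_zero]
  · exact fun v hv => hker _ (Submodule.sub_mem _ hx0 hxs_row) v hv
end
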